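/- Fix an integer d ≥ 3, a finite set M, an invariant probability measure μ ∈ I_d(M) and an integer r ≥ 0. Then the function α ↦ (h̄(μ,r,α), h̲(μ,r,α)) is constant on the interval (0,1); that is, the upper and lower entropies h̄(μ,r,α) and h̲(μ,r,α) do not depend on the choice of α ∈ (0,1). -/

import Mathlib

open MeasureTheory Filter Topology
open scoped ENNReal Classical

noncomputable section

namespace TreeEntropy

@[ext]
structure RCG (M : Type*) where
  col : List ℕ → Option M
  adj : List ℕ × List ℕ → Bool

variable {M : Type*}

def resS (r : ℕ) (g : RCG M) : RCG M where
  col l := if l.length ≤ r then g.col l else none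
  adj p := if p.1.length ≤ r ∧ p.2.length ≤ r then g.adj p else false

def rcgDist (g g' : RCG M) : ℝ :=
  ∑' r : ℕ, if resS r g = resS r g' then 0 else (2:ℝ)⁻¹ ^ r

private lemma rcg_summable (a b : RCG M) : Summable
    (fun r : ℕ => if resS r a = resS r b then (0:ℝ) else (2:ℝ)⁻¹ ^ r) := by
  refine Summable.of_nonneg_of_le (fun r => ?_) (fun r => ?_)
    (summable_geometric_of_lt_one (by norm_num) (by norm_num : (2:ℝ)⁻¹ < 1))
  · split
    · exact le_rfl
    · positivity
  · split
    · positivity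
    · exact le_rfl

private lemma rcg_nonneg (a b : RCG M) (r : ℕ) :
    (0:ℝ) ≤ if resS r a = resS r b then (0:ℝ) else (2:ℝ)⁻¹ ^ r := by
  split
  · exact le_rfl
  · positivity

private lemma rcgDist_self (g : RCG M) : rcgDist g g = 0 := by simp [rcgDist]

private lemma rcgDist_comm (g g' : RCG M) : rcgDist g g' = rcgDist g' g :=
  tsum_congr fun r => if_congr eq_comm rfl rfl

private lemma rcgDist_triangle (g₁ g₂ g₃ : RCG M) :
    rcgDist g₁ g₃ ≤ rcgDist g₁ g₂ + rcgDist g₂ g₃ := by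
  unfold rcgDist
  rw [← Summable.tsum_add (rcg_summable _ _) (rcg_summable _ _)]
  refine Summable.tsum_le_tsum (fun r => ?_) (rcg_summable _ _)
    ((rcg_summable _ _).add (rcg_summable _ _))
  have hx : (0:ℝ) ≤ (2:ℝ)⁻¹ ^ r := by positivity
  by_cases h12 : resS r g₁ = resS r g₂
  · by_cases h23 : resS r g₂ = resS r g₃
    · rw [if_pos h12, if_pos h23, if_pos (h12.trans h23)]; linarith
    · rw [if_pos h12, if_neg h23, zero_add]
      split_ifs <;> linarith
  · by_cases h23 : resS r g₂ = resS r g₃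
    · rw [if_neg h12, if_pos h23, add_zero]
      split_ifs <;> linarith
    · rw [if_neg h12, if_neg h23]
      split_ifs <;> linarith

private lemma rcgDist_eq_zero (g g' : RCG M) (h : rcgDist g g' = 0) : g = g' := by
  unfold rcgDist at h
  have hr : ∀ r : ℕ, resS r g = resS r g' := by
    intro r
    by_contra hne
    have hpos : (0:ℝ) <
        ∑' r : ℕ, if resS r g = resS r g' then (0:ℝ) else (2:ℝ)⁻¹ ^ r :=
      Summable.tsum_pos (rcg_summable g g') (rcg_nonneg g g') r
        (by rw [if_neg hne]; positivity)
    exact absurd h hpos.ne'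
  have hc : g.col = g'.col := by
    funext l
    have h1 := congrFun (congrArg RCG.col (hr l.length)) l
    simpa [resS] using h1
  have ha : g.adj = g'.adj := by
    funext p
    have h1 := congrFun (congrArg RCG.adj (hr (max p.1.length p.2.length))) p
    simpa [resS, le_max_left, le_max_right] using h1
  exact RCG.ext hc ha

instance : MetricSpace (RCG M) where
  dist := rcgDist
  dist_self := rcgDist_self
  dist_comm := rcgDist_comm
  dist_triangle := rcgDist_triangle
  eq_of_dist_eq_zero := rcgDist_eq_zero _ _

instance : MeasurableSpace (RCG M) := borel _
instance : BorelSpace (RCG M) := ⟨rfl⟩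


/-! ### The `d`-regular tree `T_d` -/

/-- A list `l = [i_k, …, i_1]` (deepest step first) is the breadth-first-search label of a
vertex of the `d`-regular tree `T_d` iff its first (root-side) step lies in `{1, …, d}` and all
subsequent steps lie in `{1, …, d-1}`. -/
def ValidTd (d : ℕ) (l : List ℕ) : Prop :=
  (∀ i ∈ l.dropLast, 1 ≤ i ∧ i ≤ d - 1) ∧ (∀ i ∈ l.getLast?, 1 ≤ i ∧ i ≤ d)

/-- The vertex set of the `d`-regular tree `T_d`. -/
def TdVertex (d : ℕ) : Type := {l : List ℕ // ValidTd d l}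

/-- The root `o` of `T_d`. -/
def rootTd (d : ℕ) : TdVertex d := ⟨[], by constructor <;> simp [List.getLast?]⟩

/-- The first neighbor `1` of the root of `T_d` (defined as the root for the degenerate case
`d = 0`, which never occurs below). -/
def node1 (d : ℕ) : TdVertex d :=
  if h : 1 ≤ d then ⟨[1], by constructor <;> simp [List.getLast?, h]⟩ else rootTd d

/-- The graph structure of the `d`-regular tree: two vertices are adjacent iff one is obtained
from the other by adding one step. -/
def TdGraph (d : ℕ) : SimpleGraph (TdVertex d) where
  Adj v w := (∃ i, w.1 = i :: v.1) ∨ (∃ i, v.1 = i :: w.1)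
  symm := by constructor; intro v w h; tauto
  loopless := by
    constructor
    rintro v (⟨i, h⟩ | ⟨i, h⟩) <;>
      · have := congrArg List.length h
        simp at this

/-- Graph distance between two vertices of a tree encoded by their BFS labels: the nearest
common ancestor corresponds to the longest common suffix. -/
def treeDist (u w : List ℕ) : ℕ :=
  ((u.reverse.zip w.reverse).takeWhile (fun p => p.1 = p.2)).length |> fun c =>
    (u.length - c) + (w.length - c)

/-- The ball `S_r = B_r(o)` of radius `r` around the root of `T_d`. -/
def SrSet (d r : ℕ) : Set (TdVertex d) := {v | v.1.length ≤ r}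

/-- The set `E_r = B_{r-1}({o,1})` of vertices at distance at most `r-1` from the edge `{o,1}`
of `T_d` (for `r ≥ 1`). -/
def ErSet (d r : ℕ) : Set (TdVertex d) :=
  {v | v.1.length + 1 ≤ r ∨ (v.1.getLast? = some 1 ∧ v.1.length ≤ r)}

lemma ErSet_subset_SrSet (d r : ℕ) : ErSet d r ⊆ SrSet d r := by
  rintro v (h | ⟨-, h⟩) <;> simp only [SrSet, Set.mem_setOf_eq] <;> omega

/-! ### Invariant processes on `T_d` and their entropies -/

variable (d : ℕ) (M : Type*)

/-- `I_d(M)`: the set of probability measures on `M^{T_d}` invariant under all automorphisms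
of the tree `T_d`. -/
def InvMeas [MeasurableSpace M] : Set (Measure (TdVertex d → M)) :=
  {μ | IsProbabilityMeasure μ ∧
    ∀ φ : TdGraph d ≃g TdGraph d, μ.map (fun x => fun v => x (φ v)) = μ}

variable {d M}

/-- The Shannon entropy of (the distribution of) a random variable with law `μ`, a measure
with countable support on a discrete space. -/
def shannon {α : Type*} [MeasurableSpace α] (μ : Measure α) : ℝ :=
  ∑' a : α, Real.negMulLog (μ {a}).toReal

/-- The restriction `X_S` of a process `X` on `T_d` to a subset `S` of the vertices:
the pushforward of its law. -/
def restrictTo [MeasurableSpace M] (S : Set (TdVertex d))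
    (μ : Measure (TdVertex d → M)) : Measure (↥S → M) :=
  μ.map (fun x => fun v => x v.1)

/-- The annealed entropy `Σ_r(μ) = H(X_{S_r}) - (d/2) H(X_{E_r})`. -/
def SigmaR [MeasurableSpace M] (d : ℕ) (r : ℕ) (μ : Measure (TdVertex d → M)) : ℝ :=
  shannon (restrictTo (SrSet d r) μ) - (d / 2 : ℝ) * shannon (restrictTo (ErSet d r) μ)

/-- The annealed entropy `Σ(μ) = lim_r Σ_r(μ)`: the limit of the non-increasing sequence
`r ↦ Σ_r(μ)` (`r ≥ 1`), as an extended real (the limit may be `-∞`). -/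
def SigmaInf [MeasurableSpace M] (d : ℕ) (μ : Measure (TdVertex d → M)) : EReal :=
  ⨅ r : ℕ, ((SigmaR d (r + 1) μ : ℝ) : EReal)

/-- `Σ_e(X) = (d/2) H(X_{E_1}) - (d-1) H(X_o)`. -/
def SigmaE [MeasurableSpace M] (d : ℕ) (μ : Measure (TdVertex d → M)) : ℝ :=
  (d / 2 : ℝ) * shannon (restrictTo (ErSet d 1) μ)
    - ((d : ℝ) - 1) * shannon (restrictTo ({rootTd d} : Set (TdVertex d)) μ)

/-! ### Markov processes on `T_d` -/

/-- The elementary cylinder event: the coloring takes the values prescribed by `y` on `S`. -/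
def cylEvent (S : Set (TdVertex d)) (y : TdVertex d → M) : Set (TdVertex d → M) :=
  {x | ∀ v ∈ S, x v = y v}

/-- The side of the edge `{u,w}` containing `u`, in the tree `T_d`. -/
def sideOf (u w : TdVertex d) : Set (TdVertex d) :=
  {v | treeDist v.1 u.1 < treeDist v.1 w.1}

/-- `B_{r-1}({u,w})`: the set of vertices at distance at most `r-1` from the edge `{u,w}`. -/
def edgeBall (r : ℕ) (u w : TdVertex d) : Set (TdVertex d) :=
  {v | treeDist v.1 u.1 + 1 ≤ r ∨ treeDist v.1 w.1 + 1 ≤ r}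

/-- A probability measure on `M^{T_d}` is `r`-Markov on a subset `A` of `T_d` if, for every
edge `{u,w}` of `A`, conditioned on the value on the `(r-1)`-neighborhood of the edge
(within `A`), the processes on the two sides of the edge (within `A`) are independent;
equivalently, the corresponding products of cylinder probabilities agree.  For `A` the whole
tree and `r = 1` this is the edge-Markov property. -/
def rMarkovOn [MeasurableSpace M] (r : ℕ) (A : Set (TdVertex d))
    (μ : Measure (TdVertex d → M)) : Prop :=
  ∀ u w : TdVertex d, u ∈ A → w ∈ A → (TdGraph d).Adj u w →
    ∀ F₁ F₂ : Finset (TdVertex d), ↑F₁ ⊆ sideOf u w ∩ A → ↑F₂ ⊆ sideOf w u ∩ A →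
      ∀ y : TdVertex d → M,
        μ (cylEvent (↑F₁ ∪ ↑F₂ ∪ (edgeBall r u w ∩ A)) y)
            * μ (cylEvent (edgeBall r u w ∩ A) y)
          = μ (cylEvent (↑F₁ ∪ (edgeBall r u w ∩ A)) y)
            * μ (cylEvent (↑F₂ ∪ (edgeBall r u w ∩ A)) y)

/-- A probability measure on `M^{T_d}` is `r`-Markov if, conditioned on the value on the
`(r-1)`-neighborhood of any edge, the processes on the two sides of the edge are
independent. -/
def rMarkov [MeasurableSpace M] (r : ℕ) (μ : Measure (TdVertex d → M)) : Prop :=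
  rMarkovOn r Set.univ μ

/-- A probability measure on `M^{T_d}` is vertex-Markov if, conditioned on the value at a
vertex, the processes on the pending subtrees of that vertex are independent. -/
def vertexMarkov [MeasurableSpace M] (μ : Measure (TdVertex d → M)) : Prop :=
  ∀ v : TdVertex d, ∀ k : ℕ, ∀ u : Fin k → TdVertex d,
    Function.Injective u → (∀ i, (TdGraph d).Adj v (u i)) →
    ∀ F : Fin k → Finset (TdVertex d), (∀ i, ↑(F i) ⊆ sideOf (u i) v) →
      ∀ y : TdVertex d → M,
        μ (cylEvent ((⋃ i, ↑(F i)) ∪ {v}) y) * (μ (cylEvent {v} y)) ^ (k - 1)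
          = ∏ i : Fin k, μ (cylEvent (↑(F i) ∪ {v}) y)

/-- `X_{S_1}` is a vertex-Markov process on `S_1`: the values at the `d` neighbors of the
root are conditionally independent given the value at the root. -/
def vertexMarkovOnS1 [MeasurableSpace M] (d : ℕ) (μ : Measure (TdVertex d → M)) : Prop :=
  ∀ y : TdVertex d → M,
    μ (cylEvent (SrSet d 1) y) * (μ (cylEvent ({rootTd d} : Set (TdVertex d)) y)) ^ (d - 1)
      = ∏ i ∈ Finset.Icc 1 d,
          μ (cylEvent {v : TdVertex d | v = rootTd d ∨ v.1 = [i]} y)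


/-! ### The randomly labeled rooted colored graph associated to a finite colored graph

Given a finite colored graph `(G,f)` and a vertex `v`, the associated randomly labeled rooted
colored graph is obtained by a breadth-first search exploration of the connected component of
`v` started at `v`, ties between vertices being broken uniformly at random.  We implement the
uniformly random tie-breaking by a uniformly random priority permutation `σ`. -/

variable {M : Type*} {n : ℕ}

/-- The `k`-th layer of the breadth-first search of `G` started at `v`, ordered according to
the position of the parents in the previous layer, ties being broken by the priority `σ`. -/
def bfsLayer (G : SimpleGraph (Fin n)) (v : Fin n) (σ : Equiv.Perm (Fin n)) :
    ℕ → List (Fin n)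
  | 0 => [v]
  | (k + 1) =>
    let prev := bfsLayer G v σ k
    let key : Fin n → ℕ := fun w =>
      (prev.idxOf (((prev.find? (fun u => decide (G.Adj u w))).getD v))) * n + (σ w : ℕ)
    ((List.finRange n).filter
        (fun w => decide (G.Reachable v w ∧ G.dist v w = k + 1))).mergeSort
      (fun a b => key a ≤ key b)

/-- The breadth-first-search label of the vertex `w` lying in layer `k` of the exploration of
`G` started at `v` with tie-breaking priority `σ`. -/
def bfsPathAux (G : SimpleGraph (Fin n)) (v : Fin n) (σ : Equiv.Perm (Fin n)) :
    ℕ → Fin n → Option (List ℕ)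
  | 0, w => if w = v then some [] else none
  | (k + 1), w =>
    match (bfsLayer G v σ k).find? (fun u => decide (G.Adj u w)) with
    | none => none
    | some p =>
      let L := bfsLayer G v σ (k + 1)
      let j := 1 + ((L.takeWhile (fun w' => w' ≠ w)).filter
        (fun w' => (bfsLayer G v σ k).find? (fun u => decide (G.Adj u w')) = some p)).length
      (bfsPathAux G v σ k p).map (fun pl => j :: pl)

/-- The breadth-first-search label of the vertex `w` in the exploration of the connected
component of `v` in `G`, with tie-breaking priority `σ` (`none` if `w` is not in the component
of `v`). -/
def bfsPath (G : SimpleGraph (Fin n)) (v : Fin n) (σ : Equiv.Perm (Fin n)) (w : Fin n) :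
    Option (List ℕ) :=
  if G.Reachable v w then bfsPathAux G v σ (G.dist v w) w else none

/-- The rooted colored graph obtained from the colored graph `(G,f)` by the breadth-first
search exploration of the connected component of `v` rooted at `v`, with tie-breaking
priority `σ`. -/
def bfsRCG (G : SimpleGraph (Fin n)) (f : Fin n → M) (v : Fin n) (σ : Equiv.Perm (Fin n)) :
    RCG M where
  col l := if h : ∃ w, bfsPath G v σ w = some l then some (f h.choose) else none
  adj p :=
    if (∃ w₁ w₂, bfsPath G v σ w₁ = some p.1 ∧ bfsPath G v σ w₂ = some p.2 ∧ G.Adj w₁ w₂)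
    then true else false

/-- `distr_{G,v}(f)`: the law of the randomly labeled rooted colored graph obtained from the
connected component of `v` in the colored graph `(G,f)`, rooted at `v`. -/
def distrAt (G : SimpleGraph (Fin n)) (f : Fin n → M) (v : Fin n) : Measure (RCG M) :=
  ((Nat.factorial n : ℝ≥0∞))⁻¹ •
    ∑ σ : Equiv.Perm (Fin n), Measure.dirac (bfsRCG G f v σ)

/-- `distr_G(f) = (1/|V|) ∑_{v ∈ V} distr_{G,v}(f)`. -/
def distrG (G : SimpleGraph (Fin n)) (f : Fin n → M) : Measure (RCG M) :=
  ((n : ℝ≥0∞))⁻¹ • ∑ v : Fin n, distrAt G f v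

/-! ### Random regular graphs -/

/-- The set `𝓖_n(d)` of simple `d`-regular graphs on the vertex set `{1, …, n}`. -/
def regularGraphs (d n : ℕ) : Set (SimpleGraph (Fin n)) :=
  {G | ∀ v, (G.neighborSet v).ncard = d}

/-- The probability that a uniformly distributed random `d`-regular graph `G_n` on `n`
vertices belongs to `A`. -/
def PrG (d n : ℕ) (A : Set (SimpleGraph (Fin n))) : ℝ :=
  ((regularGraphs d n ∩ A).ncard : ℝ) / ((regularGraphs d n).ncard : ℝ)

/-- The expectation of `F(G_n)` for a uniformly distributed random `d`-regular graph `G_n`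
on `n` vertices. -/
def ExG (d n : ℕ) (F : SimpleGraph (Fin n) → ℝ) : ℝ :=
  (∑ᶠ G ∈ regularGraphs d n, F G) / ((regularGraphs d n).ncard : ℝ)

/-- The integers `n` for which the set of simple `d`-regular graphs on `n` vertices is
non-empty: `n ≥ d + 1` and `nd` even.  Limits `n → ∞` are taken along this set. -/
def goodN (d : ℕ) : Set ℕ := {n | d + 1 ≤ n ∧ Even (n * d)}

/-- The filter `n → ∞` along `{n : n ≥ d+1, nd even}`. -/
def goodFilter (d : ℕ) : Filter ℕ := Filter.atTop ⊓ Filter.principal (goodN d)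

/-! ### The embedding of invariant processes into rooted colored graphs -/

/-- The rooted colored graph `(T_d, x, o)` associated to a coloring `x` of `T_d` (the
canonical labeling of `T_d` is a breadth-first-search labeling; for an invariant process the
resulting law is that of the randomly labeled rooted colored graph). -/
def iotaTd (d : ℕ) (x : TdVertex d → M) : RCG M where
  col l := if h : ValidTd d l then some (x ⟨l, h⟩) else none
  adj p :=
    if (ValidTd d p.1 ∧ ValidTd d p.2 ∧ ((∃ i, p.2 = i :: p.1) ∨ (∃ i, p.1 = i :: p.2)))
    then true else false

/-- The law, as a probability measure on rooted colored graphs, of the randomly labeled rooted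
colored tree `(T_d, X, o)` where `X` has law `μ`. -/
def lawTd (d : ℕ) [MeasurableSpace M] (μ : Measure (TdVertex d → M)) : Measure (RCG M) :=
  μ.map (iotaTd d)

/-! ### Micro-state (sofic) entropy -/

/-- `𝓕_G(μ,r,ε)`: the set of colorings `f` of `G` whose radius-`r` local statistics are
`ε`-close (in the Lévy-Prokhorov distance, which generates the weak topology) to the
radius-`r` restriction of `μ`. -/
def FSet (d : ℕ) [MeasurableSpace M] (μ : Measure (TdVertex d → M)) (r : ℕ) (ε : ℝ)
    (G : SimpleGraph (Fin n)) : Set (Fin n → M) :=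
  {f | levyProkhorovDist ((distrG G f).map (resS r)) ((lawTd d μ).map (resS r)) ≤ ε}

/-- `H_{G}(μ,r,ε) = (1/n) log |𝓕_G(μ,r,ε)| ∈ {-∞} ∪ [0,∞)`. -/
def HG (d : ℕ) [MeasurableSpace M] (μ : Measure (TdVertex d → M)) (r : ℕ) (ε : ℝ)
    (G : SimpleGraph (Fin n)) : EReal :=
  if FSet d μ r ε G = ∅ then ⊥
  else ((Real.log ((FSet d μ r ε G).ncard) / n : ℝ) : EReal)

/-- `h_n(μ,r,ε,α)`: the `α`-quantile
`sup { h ∈ {-∞} ∪ [0,∞) : ℙ(H_{G_n}(μ,r,ε) ≥ h) ≥ α }`. -/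
def hquant (d : ℕ) [MeasurableSpace M] (μ : Measure (TdVertex d → M)) (r : ℕ) (ε : ℝ)
    (α : ℝ) (n : ℕ) : EReal :=
  sSup {h : EReal | (h = ⊥ ∨ 0 ≤ h) ∧
    α ≤ PrG d n {G : SimpleGraph (Fin n) | h ≤ HG d μ r ε G}}

/-- The upper entropy `h̄(μ,r,α) = lim_{ε → 0} limsup_n h_n(μ,r,ε,α)` (the limit over `ε`
of a quantity non-decreasing in `ε`, i.e. the infimum over `ε > 0`). -/
def hbarA (d : ℕ) [MeasurableSpace M] (μ : Measure (TdVertex d → M)) (r : ℕ) (α : ℝ) :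
    EReal :=
  ⨅ ε : {e : ℝ // 0 < e}, (goodFilter d).limsup (fun n => hquant d μ r ε.1 α n)

/-- The lower entropy `h̲(μ,r,α) = lim_{ε → 0} liminf_n h_n(μ,r,ε,α)`. -/
def hlowA (d : ℕ) [MeasurableSpace M] (μ : Measure (TdVertex d → M)) (r : ℕ) (α : ℝ) :
    EReal :=
  ⨅ ε : {e : ℝ // 0 < e}, (goodFilter d).liminf (fun n => hquant d μ r ε.1 α n)

/-- `h̄(μ,r)`: the common value of `h̄(μ,r,α)`, `0 < α < 1`. -/
def hbarR (d : ℕ) [MeasurableSpace M] (μ : Measure (TdVertex d → M)) (r : ℕ) : EReal :=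
  hbarA d μ r (1 / 2)

/-- `h̲(μ,r)`: the common value of `h̲(μ,r,α)`, `0 < α < 1`. -/
def hlowR (d : ℕ) [MeasurableSpace M] (μ : Measure (TdVertex d → M)) (r : ℕ) : EReal :=
  hlowA d μ r (1 / 2)

/-- The upper sofic entropy `h̄(μ) = lim_{r → ∞} h̄(μ,r)` (the limit of a non-increasing
sequence, i.e. the infimum over `r`). -/
def hbar (d : ℕ) [MeasurableSpace M] (μ : Measure (TdVertex d → M)) : EReal :=
  ⨅ r : ℕ, hbarR d μ r

/-- The lower sofic entropy `h̲(μ) = lim_{r → ∞} h̲(μ,r)`. -/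
def hlow (d : ℕ) [MeasurableSpace M] (μ : Measure (TdVertex d → M)) : EReal :=
  ⨅ r : ℕ, hlowR d μ r

/-! ### Typical processes -/

/-- The probability that the random `d`-regular graph `G_n` admits a coloring whose local
statistics are `ε`-close to `μ`. -/
def typicalPr (d : ℕ) [MeasurableSpace M] (μ : Measure (TdVertex d → M)) (ε : ℝ) (n : ℕ) :
    ℝ :=
  PrG d n {G : SimpleGraph (Fin n) |
    ∃ f : Fin n → M, levyProkhorovDist (distrG G f) (lawTd d μ) ≤ ε}

/-- `μ ∈ I_d(M)` is weakly typical if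
`lim_{ε → 0} limsup_{n → ∞} ℙ(∃ f : d(distr_{G_n}(f), μ) ≤ ε) = 1`. -/
def WeaklyTypical (d : ℕ) [MeasurableSpace M] (μ : Measure (TdVertex d → M)) : Prop :=
  Tendsto (fun ε => (goodFilter d).limsup (fun n => typicalPr d μ ε n))
    (nhdsWithin 0 (Set.Ioi 0)) (nhds 1)

/-- `μ ∈ I_d(M)` is strongly typical if
`lim_{ε → 0} lim_{n → ∞} ℙ(∃ f : d(distr_{G_n}(f), μ) ≤ ε) = 1` (in particular the inner
limits along `n → ∞` exist). -/
def StronglyTypical (d : ℕ) [MeasurableSpace M] (μ : Measure (TdVertex d → M)) : Prop :=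
  ∃ L : ℝ → ℝ,
    (∀ ε : ℝ, 0 < ε → Tendsto (fun n => typicalPr d μ ε n) (goodFilter d) (nhds (L ε))) ∧
    Tendsto L (nhdsWithin 0 (Set.Ioi 0)) (nhds 1)


/-! ### Processes on balls of `T_d` and the sets `I_{d,r}(M)`, `I_e(M)` -/

/-- The ball `S_r` of `T_d` as an induced subgraph. -/
def SrGraph (d r : ℕ) : SimpleGraph ↥(SrSet d r) := (TdGraph d).induce (SrSet d r)

/-- The set `E_r` of `T_d` as an induced subgraph. -/
def ErGraph (d r : ℕ) : SimpleGraph ↥(ErSet d r) := (TdGraph d).induce (ErSet d r)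

lemma root_mem_Er (d r : ℕ) (hr : 1 ≤ r) : rootTd d ∈ ErSet d r := by
  left; simpa [rootTd] using hr

lemma node1_mem_Er (d r : ℕ) (hr : 1 ≤ r) : node1 d ∈ ErSet d r := by
  by_cases h : 1 ≤ d
  · right
    constructor <;> simp [node1, h, List.getLast?, hr]
  · simpa [node1, h] using root_mem_Er d r hr

variable {M : Type*}

/-- The restriction to `E_r ⊆ S_r` of a probability measure on `M^{S_r}`. -/
def restrictErOfSr [MeasurableSpace M] (d r : ℕ) (p : Measure (↥(SrSet d r) → M)) :
    Measure (↥(ErSet d r) → M) :=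
  p.map (fun x => fun v : ↥(ErSet d r) => x ⟨v.1, ErSet_subset_SrSet d r v.2⟩)

/-- `I_{d,r}(M)`: the set of probability measures on `M^{S_r}` which are invariant under the
automorphisms of `S_r` and whose restriction to `E_r` is invariant under switching the two
sides of the edge `{o,1}`. -/
def IdrMeas (d r : ℕ) (M : Type*) [MeasurableSpace M] :
    Set (Measure (↥(SrSet d r) → M)) :=
  {p | IsProbabilityMeasure p ∧
    (∀ φ : SrGraph d r ≃g SrGraph d r, p.map (fun x => fun v => x (φ v)) = p) ∧
    (∀ ψ : ErGraph d r ≃g ErGraph d r,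
      (∀ hv : rootTd d ∈ ErSet d r, ((ψ ⟨rootTd d, hv⟩ : ↥(ErSet d r)) : TdVertex d) = node1 d) →
      (restrictErOfSr d r p).map (fun x => fun v => x (ψ v)) = restrictErOfSr d r p)}

/-- The annealed entropy `Σ(p) = H(X_{S_r}) - (d/2) H(X_{E_r})` of `p ∈ I_{d,r}(M)`. -/
def SigmaP [MeasurableSpace M] (d r : ℕ) (p : Measure (↥(SrSet d r) → M)) : ℝ :=
  shannon p - (d / 2 : ℝ) * shannon (restrictErOfSr d r p)

/-- The involution of `E_1 = {o, 1}` switching the two sides of the edge `{o,1}`. -/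
def swapE1 (d : ℕ) : ↥(ErSet d 1) → ↥(ErSet d 1) := fun v =>
  if (v : TdVertex d) = rootTd d then ⟨node1 d, node1_mem_Er d 1 le_rfl⟩
  else ⟨rootTd d, root_mem_Er d 1 le_rfl⟩

/-- `I_e(M)`: the set of probability measures on `M^{E_1}` invariant under switching the two
sides of the edge `{o,1}`. -/
def IeMeas (d : ℕ) (M : Type*) [MeasurableSpace M] : Set (Measure (↥(ErSet d 1) → M)) :=
  {p | IsProbabilityMeasure p ∧ p.map (fun x => fun v => x (swapE1 d v)) = p}

/-- The annealed entropy `Σ(p) = (d/2) H(X_{E_1}) - (d-1) H(X_o)` of `p ∈ I_e(M)`. -/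
def SigmaPe [MeasurableSpace M] (d : ℕ) (p : Measure (↥(ErSet d 1) → M)) : ℝ :=
  (d / 2 : ℝ) * shannon p
    - ((d : ℝ) - 1) * shannon (p.map (fun x => x ⟨rootTd d, root_mem_Er d 1 le_rfl⟩))

/-! ### Factor graphs: functions of rooted unlabeled colored graphs of radius `r` -/

/-- The vertex set of a rooted colored graph. -/
def vertsOf (g : RCG M) : Set (List ℕ) := {l | g.col l ≠ none}

/-- An isomorphism of rooted colored graphs (a color- and adjacency-preserving bijection of
the vertex sets mapping root to root). -/
def RCGRootedIso (g g' : RCG M) : Prop :=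
  ∃ e : ↥(vertsOf g) ≃ ↥(vertsOf g'),
    (∀ v, g'.col ((e v) : List ℕ) = g.col (v : List ℕ)) ∧
    (∀ v w, g'.adj (((e v) : List ℕ), ((e w) : List ℕ)) = g.adj ((v : List ℕ), (w : List ℕ))) ∧
    (∀ h : [] ∈ vertsOf g, ∀ _ : [] ∈ vertsOf g', ((e ⟨[], h⟩) : List ℕ) = [])

/-- A function on rooted unlabeled colored graphs of radius `r`: a function of rooted colored
graphs which only depends on the isomorphism class of the ball of radius `r` around the
root. -/
def IsRadiusRFn (r : ℕ) (ψ : RCG M → ℝ) : Prop :=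
  ∀ g g' : RCG M, RCGRootedIso (resS r g) (resS r g') → ψ g = ψ g'

/-- The value `ψ((G,f,v)_r)` of `ψ` at the rooted unlabeled colored graph given by the ball of
radius `r` around `v` in `(G,f)` (computed as the average over the random labelings, which is
the constant value of `ψ` on them when `ψ` is a function of the unlabeled graph). -/
def psiAt {n : ℕ} (G : SimpleGraph (Fin n)) (f : Fin n → M) (v : Fin n) (ψ : RCG M → ℝ) :
    ℝ :=
  ∫ g, ψ g ∂(distrAt G f v)

/-- The partition function `Z_G = ∑_f ∏_v exp(ψ((G,f,v)_r))` of the factor model `ψ`. -/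
def ZG {n : ℕ} [Fintype M] (G : SimpleGraph (Fin n)) (ψ : RCG M → ℝ) : ℝ :=
  ∑ f : Fin n → M, Real.exp (∑ v : Fin n, psiAt G f v ψ)

/-- The ground-state energy `L_G = max_f ∑_v ψ((G,f,v)_r)`. -/
def LG {n : ℕ} (G : SimpleGraph (Fin n)) (ψ : RCG M → ℝ) : ℝ :=
  sSup {x : ℝ | ∃ f : Fin n → M, x = ∑ v : Fin n, psiAt G f v ψ}

/-- The canonical rooted colored graph associated to a coloring of the ball `S_r` of `T_d`. -/
def iotaSr (d r : ℕ) (x : ↥(SrSet d r) → M) : RCG M where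
  col l := if h : ValidTd d l ∧ l.length ≤ r then some (x ⟨⟨l, h.1⟩, h.2⟩) else none
  adj p := if (ValidTd d p.1 ∧ ValidTd d p.2 ∧ p.1.length ≤ r ∧ p.2.length ≤ r ∧
      ((∃ i, p.2 = i :: p.1) ∨ (∃ i, p.1 = i :: p.2))) then true else false

/-- `⟨p, ψ⟩ = E[ψ(X)]` where `X` has law `p ∈ I_{d,r}(M)`. -/
def pairing [MeasurableSpace M] (d r : ℕ) (p : Measure (↥(SrSet d r) → M))
    (ψ : RCG M → ℝ) : ℝ :=
  ∫ x, ψ (iotaSr d r x) ∂p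

/-! ### Annealed quantities for random regular graphs -/

/-- `log` with the convention `log 0 = -∞`, with values in the extended reals. -/
def elog (x : ℝ) : EReal := if x ≤ 0 then ⊥ else ((Real.log x : ℝ) : EReal)

/-- The set `𝓖_n(μ,r,ε)` of pairs `(G,f)` of a `d`-regular graph together with a coloring
whose radius-`r` local statistics are `ε`-close to `μ_r`. -/
def GnPairs (d : ℕ) [MeasurableSpace M] (μ : Measure (TdVertex d → M)) (r : ℕ) (ε : ℝ)
    (n : ℕ) : Set (SimpleGraph (Fin n) × (Fin n → M)) :=
  {Gf | Gf.1 ∈ regularGraphs d n ∧ Gf.2 ∈ FSet d μ r ε Gf.1}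

/-- The annealed entropy
`Σ_n(μ,r,ε) = (1/n) (log |𝓖_n(μ,r,ε)| - log |𝓖_n(d)|) = (1/n) log E |𝓕_{G_n}(μ,r,ε)|`. -/
def SigmaN (d : ℕ) [MeasurableSpace M] (μ : Measure (TdVertex d → M)) (r : ℕ) (ε : ℝ)
    (n : ℕ) : EReal :=
  (((n : ℝ)⁻¹ : ℝ) : EReal) *
    elog (((GnPairs d μ r ε n).ncard : ℝ) / ((regularGraphs d n).ncard : ℝ))

/-- The relaxed partition function `Z_G(β) = ∑_f exp(-nβ d(distr_G(f)_r, μ_r))`. -/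
def ZGbeta (d : ℕ) [MeasurableSpace M] {n : ℕ} [Fintype M] (μ : Measure (TdVertex d → M))
    (r : ℕ) (β : ℝ) (G : SimpleGraph (Fin n)) : ℝ :=
  ∑ f : Fin n → M, Real.exp (-(n : ℝ) * β *
    levyProkhorovDist ((distrG G f).map (resS r)) ((lawTd d μ).map (resS r)))


/-! ### Processes on unimodular Galton-Watson trees

A colored rooted tree `(T, X, o)` with `T` a subtree of the label set, rooted at `[]` and
with the children of a vertex `v` labeled `1 :: v, …, N_v :: v`, is encoded as a rooted
colored graph in `RCG M`. -/

/-- `g` is a canonically labeled colored rooted tree. -/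
def IsCanonTree (g : RCG M) : Prop :=
  g.col [] ≠ none ∧
  (∀ l : List ℕ, g.col l ≠ none → g.col l.tail ≠ none) ∧
  (∀ (v : List ℕ) (i : ℕ), 1 ≤ i → g.col ((i + 1) :: v) ≠ none → g.col (i :: v) ≠ none) ∧
  (∀ v : List ℕ, g.col (0 :: v) = none) ∧
  (∀ p : List ℕ × List ℕ, g.adj p = true ↔
    (g.col p.1 ≠ none ∧ g.col p.2 ≠ none ∧
      ((∃ i, p.2 = i :: p.1) ∨ (∃ i, p.1 = i :: p.2))))

/-- A finite canonically labeled tree. -/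
def IsFinTree (t : Finset (List ℕ)) : Prop :=
  [] ∈ t ∧ (∀ l ∈ t, l.tail ∈ t) ∧
  (∀ (v : List ℕ) (i : ℕ), 1 ≤ i → ((i + 1) :: v) ∈ t → (i :: v) ∈ t) ∧
  (∀ v : List ℕ, (0 :: v) ∉ t)

/-- The number of children of the vertex `v` in the finite tree `t`. -/
def childCountF (t : Finset (List ℕ)) (v : List ℕ) : ℕ :=
  (t.filter (fun w => w ≠ [] ∧ w.tail = v)).card

/-- The size-biased version `π̂(k) = (k+1) π(k+1) / d` of the offspring distribution `π`. -/
def sizeBiased (π : ℕ → ℝ) (dd : ℝ) (k : ℕ) : ℝ := (k + 1 : ℝ) * π (k + 1) / dd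

/-- The probability that the unimodular Galton-Watson tree with degree distribution `π`,
truncated at depth `k`, equals the finite tree `t`. -/
def treeWeight (π : ℕ → ℝ) (dd : ℝ) (k : ℕ) (t : Finset (List ℕ)) : ℝ :=
  π (childCountF t []) *
    ∏ v ∈ t.filter (fun v => v ≠ [] ∧ v.length < k), sizeBiased π dd (childCountF t v)

/-- The law of the underlying tree is the unimodular Galton-Watson law `UGW(π)`:
all finite-depth truncations have the prescribed distribution. -/
def IsUGWTreeLaw (π : ℕ → ℝ) (dd : ℝ) (μ : Measure (RCG M)) : Prop :=
  ∀ (k : ℕ) (t : Finset (List ℕ)), IsFinTree t → (∀ v ∈ t, v.length ≤ k) →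
    (μ {g | ∀ l : List ℕ, l.length ≤ k → (g.col l ≠ none ↔ l ∈ t)}).toReal
      = treeWeight π dd k t

/-- `e` realizes an isomorphism (not necessarily root-preserving) of the colored graphs `g`
and `g'`. -/
def IsIsoVia (g g' : RCG M) (e : List ℕ → List ℕ) : Prop :=
  Set.BijOn e (vertsOf g) (vertsOf g') ∧
  (∀ l ∈ vertsOf g, g'.col (e l) = g.col l) ∧
  (∀ l ∈ vertsOf g, ∀ l' ∈ vertsOf g, g'.adj (e l, e l') = g.adj (l, l'))

/-- A function on doubly rooted colored graphs, invariant under isomorphisms. -/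
def PairInvariant (F : RCG M → List ℕ → List ℕ → ℝ≥0∞) : Prop :=
  ∀ g g' e, IsIsoVia g g' e → ∀ u ∈ vertsOf g, ∀ v ∈ vertsOf g, F g' (e u) (e v) = F g u v

/-- Unimodularity (the mass-transport principle):
`E ∑_v F(G,o,v) = E ∑_v F(G,v,o)` for all isomorphism-invariant `F ≥ 0`. -/
def Unimodular (μ : Measure (RCG M)) : Prop :=
  ∀ F : RCG M → List ℕ → List ℕ → ℝ≥0∞, PairInvariant F →
    ∫⁻ g, (∑' v : ↥(vertsOf g), F g [] (v : List ℕ)) ∂μ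
      = ∫⁻ g, (∑' v : ↥(vertsOf g), F g (v : List ℕ) []) ∂μ

/-- `I_π(M)`: the laws of invariant (unimodular) processes `(T,X)` with colors in `M` over
the unimodular Galton-Watson tree with degree distribution `π` (of mean `dd`). -/
def IPiMeas (π : ℕ → ℝ) (dd : ℝ) (M : Type*) [MeasurableSpace M] :
    Set (Measure (RCG M)) :=
  {μ | IsProbabilityMeasure μ ∧ μ {g | IsCanonTree g} = 1 ∧ Unimodular μ ∧
    IsUGWTreeLaw π dd μ}

/-- The root degree `deg(o)` of a canonically labeled tree (the number of children of the
root). -/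
def rootDeg (g : RCG M) : ℕ := {i : ℕ | g.col [i] ≠ none}.ncard

/-- The edge-biased law `→μ(⬝) = (1/d) E[deg(o) 1{(T,X,(o,1)) ∈ ⬝}]` on colored edge-rooted
trees (the root edge being `([], [1])`). -/
def vecLaw (dd : ℝ) [MeasurableSpace M] (μ : Measure (RCG M)) : Measure (RCG M) :=
  (ENNReal.ofReal dd)⁻¹ • μ.withDensity (fun g => (rootDeg g : ℝ≥0∞))

/-- Membership in `E_r = B_{r-1}({o,1})` for a vertex of a canonically labeled tree. -/
def inErL (r : ℕ) (l : List ℕ) : Prop :=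
  l.length + 1 ≤ r ∨ (l.getLast? = some 1 ∧ l.length ≤ r)

/-- The restriction of a colored edge-rooted tree to `E_r = B_{r-1}({o,1})`. -/
def resE (r : ℕ) (g : RCG M) : RCG M where
  col l := if inErL r l then g.col l else none
  adj p := if inErL r p.1 ∧ inErL r p.2 then g.adj p else false

/-- The Shannon entropy `H(π)` of the probability mass function `π`. -/
def Hpmf (π : ℕ → ℝ) : ℝ := ∑' k : ℕ, Real.negMulLog (π k)

/-- The annealed entropy `Σ_r(μ) = H(X_{S_r}) - (d/2) H(→X_{E_r}) - H(π)` of an invariant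
process over the unimodular Galton-Watson tree. -/
def SigmaUGW (π : ℕ → ℝ) (dd : ℝ) [MeasurableSpace M] (r : ℕ) (μ : Measure (RCG M)) : ℝ :=
  shannon (μ.map (resS r)) - (dd / 2) * shannon ((vecLaw dd μ).map (resE r)) - Hpmf π

/-- `Σ(μ) = lim_{r → ∞} Σ_r(μ)` (the limit of a non-increasing sequence). -/
def SigmaUGWInf (π : ℕ → ℝ) (dd : ℝ) [MeasurableSpace M] (μ : Measure (RCG M)) : EReal :=
  ⨅ r : ℕ, ((SigmaUGW π dd (r + 1) μ : ℝ) : EReal)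

/-- `Σ_e(X) = (d/2) H(→X_{E_1}) - d H(→X_o) + H(X_o) - H(π)`. -/
def SigmaEUGW (π : ℕ → ℝ) (dd : ℝ) [MeasurableSpace M] (μ : Measure (RCG M)) : ℝ :=
  (dd / 2) * shannon ((vecLaw dd μ).map (resE 1))
    - dd * shannon ((vecLaw dd μ).map (resS 0))
    + shannon (μ.map (resS 0)) - Hpmf π

/-! ### Markov processes on random trees -/

/-- The side of the (potential) edge `{u,w}` containing `u`, among the labels. -/
def sideL (u w : List ℕ) : Set (List ℕ) := {v | treeDist v u < treeDist v w}

/-- `B_{r-1}({u,w})` among the labels. -/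
def edgeBallL (r : ℕ) (u w : List ℕ) : Set (List ℕ) :=
  {v | treeDist v u + 1 ≤ r ∨ treeDist v w + 1 ≤ r}

/-- The event that the tree structure agrees with that of `y` on `S` and that the colored
tree agrees with `y` on `B`. -/
def treeCylEvent (S B : Set (List ℕ)) (y : RCG M) : Set (RCG M) :=
  {g | (∀ l ∈ S, (g.col l ≠ none ↔ y.col l ≠ none)) ∧ (∀ l ∈ B, g.col l = y.col l)}

/-- A random colored tree is `r`-Markov on the ambient set `A` if, conditioned on the tree
and on the value on the `(r-1)`-neighborhood of an edge, the processes on the two sides of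
the edge are independent (conditioning on the tree is expressed through arbitrary finite
windows `S`). -/
def rMarkovTreeOn [MeasurableSpace M] (r : ℕ) (A : Set (List ℕ)) (μ : Measure (RCG M)) :
    Prop :=
  ∀ (u : List ℕ) (i : ℕ), 1 ≤ i → u ∈ A → (i :: u) ∈ A →
    ∀ F₁ F₂ : Finset (List ℕ), ↑F₁ ⊆ sideL u (i :: u) ∩ A → ↑F₂ ⊆ sideL (i :: u) u ∩ A →
    ∀ S : Finset (List ℕ), ↑S ⊆ A → ∀ y : RCG M,
      μ (treeCylEvent ↑S (edgeBallL r u (i :: u) ∩ A) y ∩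
          treeCylEvent ∅ ↑F₁ y ∩ treeCylEvent ∅ ↑F₂ y)
        * μ (treeCylEvent ↑S (edgeBallL r u (i :: u) ∩ A) y)
      = μ (treeCylEvent ↑S (edgeBallL r u (i :: u) ∩ A) y ∩ treeCylEvent ∅ ↑F₁ y)
        * μ (treeCylEvent ↑S (edgeBallL r u (i :: u) ∩ A) y ∩ treeCylEvent ∅ ↑F₂ y)

/-- A random colored tree is `r`-Markov if the above holds with ambient set everything. -/
def rMarkovTree [MeasurableSpace M] (r : ℕ) (μ : Measure (RCG M)) : Prop :=
  rMarkovTreeOn r Set.univ μ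

/-- A random colored tree is vertex-Markov on the ambient set `A` if, conditioned on the tree
and on the value at a vertex, the processes on the pending subtrees of that vertex are
independent. -/
def vertexMarkovTreeOn [MeasurableSpace M] (A : Set (List ℕ)) (μ : Measure (RCG M)) :
    Prop :=
  ∀ v ∈ A, ∀ (k : ℕ) (u : Fin k → List ℕ), Function.Injective u →
    (∀ j, u j ∈ A ∧ ((∃ i, 1 ≤ i ∧ u j = i :: v) ∨ (v ≠ [] ∧ u j = v.tail))) →
    ∀ F : Fin k → Finset (List ℕ), (∀ j, ↑(F j) ⊆ sideL (u j) v ∩ A) →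
    ∀ S : Finset (List ℕ), ↑S ⊆ A → ∀ y : RCG M,
      μ (treeCylEvent ↑S {v} y ∩ ⋂ j, treeCylEvent ∅ ↑(F j) y)
          * (μ (treeCylEvent ↑S {v} y)) ^ (k - 1)
        = ∏ j : Fin k, μ (treeCylEvent ↑S {v} y ∩ treeCylEvent ∅ ↑(F j) y)

/-- A random colored tree is vertex-Markov if the above holds with ambient set everything. -/
def vertexMarkovTree [MeasurableSpace M] (μ : Measure (RCG M)) : Prop :=
  vertexMarkovTreeOn Set.univ μ

/-! ### Random graphs with given degree sequences -/

/-- The set of simple graphs on `{1,…,n}` with degree sequence `dn`. -/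
def degSeqGraphs (n : ℕ) (dn : Fin n → ℕ) : Set (SimpleGraph (Fin n)) :=
  {G | ∀ v, (G.neighborSet v).ncard = dn v}

/-- The probability that a uniform random graph with degree sequence `dn` lies in `A`. -/
def PrD (n : ℕ) (dn : Fin n → ℕ) (A : Set (SimpleGraph (Fin n))) : ℝ :=
  ((degSeqGraphs n dn ∩ A).ncard : ℝ) / ((degSeqGraphs n dn).ncard : ℝ)

/-- `𝓕_G(μ,r,ε)` for a process `μ` over a unimodular Galton-Watson tree. -/
def FSetD [MeasurableSpace M] (μ : Measure (RCG M)) (r : ℕ) (ε : ℝ) {n : ℕ}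
    (G : SimpleGraph (Fin n)) : Set (Fin n → M) :=
  {f | levyProkhorovDist ((distrG G f).map (resS r)) (μ.map (resS r)) ≤ ε}

/-- `H_G(μ,r,ε) = (1/n) log |𝓕_G(μ,r,ε)|`. -/
def HGD [MeasurableSpace M] (μ : Measure (RCG M)) (r : ℕ) (ε : ℝ) {n : ℕ}
    (G : SimpleGraph (Fin n)) : EReal :=
  if FSetD μ r ε G = ∅ then ⊥
  else ((Real.log ((FSetD μ r ε G).ncard) / n : ℝ) : EReal)

/-- The `α`-quantile of `H_{G_n}(μ,r,ε)` for the uniform random graph with degree sequence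
`DN n`. -/
def hquantD [MeasurableSpace M] (DN : (n : ℕ) → Fin n → ℕ) (μ : Measure (RCG M)) (r : ℕ)
    (ε : ℝ) (α : ℝ) (n : ℕ) : EReal :=
  sSup {h : EReal | (h = ⊥ ∨ 0 ≤ h) ∧
    α ≤ PrD n (DN n) {G : SimpleGraph (Fin n) | h ≤ HGD μ r ε G}}

/-- `h̄(μ,r,α)` for the degree-sequence ensemble. -/
def hbarAD [MeasurableSpace M] (DN : (n : ℕ) → Fin n → ℕ) (μ : Measure (RCG M)) (r : ℕ)
    (α : ℝ) : EReal :=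
  ⨅ ε : {e : ℝ // 0 < e}, Filter.atTop.limsup (fun n => hquantD DN μ r ε.1 α n)

/-- `h̲(μ,r,α)` for the degree-sequence ensemble. -/
def hlowAD [MeasurableSpace M] (DN : (n : ℕ) → Fin n → ℕ) (μ : Measure (RCG M)) (r : ℕ)
    (α : ℝ) : EReal :=
  ⨅ ε : {e : ℝ // 0 < e}, Filter.atTop.liminf (fun n => hquantD DN μ r ε.1 α n)

/-- `h̄(μ,r)`: the common value of `h̄(μ,r,α)`, `0 < α < 1`. -/
def hbarRD [MeasurableSpace M] (DN : (n : ℕ) → Fin n → ℕ) (μ : Measure (RCG M)) (r : ℕ) :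
    EReal :=
  hbarAD DN μ r (1 / 2)

/-- `h̲(μ,r)`. -/
def hlowRD [MeasurableSpace M] (DN : (n : ℕ) → Fin n → ℕ) (μ : Measure (RCG M)) (r : ℕ) :
    EReal :=
  hlowAD DN μ r (1 / 2)

/-- The upper sofic entropy `h̄(μ) = lim_{r → ∞} h̄(μ,r)`. -/
def hbarD [MeasurableSpace M] (DN : (n : ℕ) → Fin n → ℕ) (μ : Measure (RCG M)) : EReal :=
  ⨅ r : ℕ, hbarRD DN μ r

/-- The lower sofic entropy `h̲(μ) = lim_{r → ∞} h̲(μ,r)`. -/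
def hlowD [MeasurableSpace M] (DN : (n : ℕ) → Fin n → ℕ) (μ : Measure (RCG M)) : EReal :=
  ⨅ r : ℕ, hlowRD DN μ r

/-- The hypotheses on the degree sequences: uniformly bounded by `Δ`, even sums, and
empirical distributions converging (weakly) to `π`. -/
def GoodDegSeq (π : ℕ → ℝ) (Δ : ℝ) (DN : (n : ℕ) → Fin n → ℕ) : Prop :=
  (∀ n v, (DN n v : ℝ) ≤ Δ) ∧ (∀ n, Even (∑ v : Fin n, DN n v)) ∧
  (∀ k : ℕ, Tendsto (fun n => (((Finset.univ.filter (fun v : Fin n => DN n v = k)).card : ℝ) / n))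
    atTop (nhds (π k)))

/-- The hypotheses on the degree distribution `π`: a probability mass function supported in
`{0,…,Δ}` with mean `dd > 0`. -/
def GoodPmf (π : ℕ → ℝ) (Δ : ℝ) (dd : ℝ) : Prop :=
  (∀ k, 0 ≤ π k) ∧ (∑' k : ℕ, π k) = 1 ∧ (∀ k : ℕ, (Δ : ℝ) < k → π k = 0) ∧
  (∑' k : ℕ, (k : ℝ) * π k) = dd ∧ 0 < dd


/-! ### Couplings -/

/-- `ν ∈ I_d(M × M)` is an invariant coupling of `μ` with itself: both coordinate marginal
processes of `ν` have law `μ`. -/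
def IsInvCoupling (d : ℕ) {M : Type*} [MeasurableSpace M] (μ : Measure (TdVertex d → M))
    (ν : Measure (TdVertex d → M × M)) : Prop :=
  ν ∈ InvMeas d (M × M) ∧ ν.map (fun x => fun v => (x v).1) = μ ∧
    ν.map (fun x => fun v => (x v).2) = μ

/-- The first coordinate marginal of a colored graph with colors in a product set. -/
def rcgFst {M₁ M₂ : Type*} (g : RCG (M₁ × M₂)) : RCG M₁ :=
  ⟨fun l => (g.col l).map Prod.fst, g.adj⟩

/-- The second coordinate marginal of a colored graph with colors in a product set. -/
def rcgSnd {M₁ M₂ : Type*} (g : RCG (M₁ × M₂)) : RCG M₂ :=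
  ⟨fun l => (g.col l).map Prod.snd, g.adj⟩

/-- `ν ∈ I_π(M × M)` is an invariant coupling of `μ ∈ I_π(M)` with itself. -/
def IsInvCouplingUGW (π : ℕ → ℝ) (dd : ℝ) {M : Type*} [MeasurableSpace M]
    (μ : Measure (RCG M)) (ν : Measure (RCG (M × M))) : Prop :=
  ν ∈ IPiMeas π dd (M × M) ∧ ν.map rcgFst = μ ∧ ν.map rcgSnd = μ

/-- A finite family of reals of oscillation at most `2` has sub-Gaussian exponential moments. -/
lemma sum_exp_le_of_oscillation {ι : Type*} [Fintype ι] [Nonempty ι] (x : ι → ℝ) (t : ℝ)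
    (ht : |t| ≤ 1 / 2) (h : ∀ i j, |x i - x j| ≤ 2) :
    ∑ i, Real.exp (t * x i) ≤
      Fintype.card ι * Real.exp (t * ((∑ i, x i) / Fintype.card ι) + 4 * t ^ 2) := by
  set c : ℝ := ((Fintype.card ι : ℕ) : ℝ) with hc
  have hc0 : 0 < c := by rw [hc]; exact_mod_cast Fintype.card_pos
  set m : ℝ := (∑ i, x i) / c with hm
  have hsum : ∑ i, (x i - m) = 0 := by
    rw [Finset.sum_sub_distrib, Finset.sum_const, Finset.card_univ, nsmul_eq_mul, ← hc, hm]
    field_simp; ring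
  have hdev : ∀ i, |x i - m| ≤ 2 := by
    intro i
    have h1 : c * (x i - m) = ∑ j, (x i - x j) := by
      rw [Finset.sum_sub_distrib, Finset.sum_const, Finset.card_univ, nsmul_eq_mul, ← hc, hm]
      field_simp
    have h2 : c * |x i - m| ≤ c * 2 := by
      rw [← abs_of_pos hc0, ← abs_mul, h1, abs_of_pos hc0]
      refine (Finset.abs_sum_le_sum_abs _ _).trans ?_
      refine (Finset.sum_le_sum fun j _ => h i j).trans ?_
      simp [hc]
    exact le_of_mul_le_mul_left h2 hc0
  have hexp : ∀ i, Real.exp (t * x i) ≤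
      Real.exp (t * m) * (1 + t * (x i - m) + 4 * t ^ 2) := by
    intro i
    have e1 : t * x i = t * m + t * (x i - m) := by ring
    rw [e1, Real.exp_add]
    refine mul_le_mul_of_nonneg_left ?_ (Real.exp_pos _).le
    have h2 : |t * (x i - m)| ≤ 1 := by
      rw [abs_mul]
      nlinarith [abs_nonneg t, abs_nonneg (x i - m), hdev i]
    have h3 := (abs_le.1 (Real.abs_exp_sub_one_sub_id_le h2)).2
    have h4 : (x i - m) ^ 2 ≤ 4 := by
      have := abs_le.1 (hdev i)
      nlinarith
    nlinarith [sq_nonneg t]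
  refine (Finset.sum_le_sum fun i _ => hexp i).trans ?_
  rw [← Finset.mul_sum, Finset.sum_add_distrib, Finset.sum_add_distrib, ← Finset.mul_sum, hsum]
  simp only [Finset.sum_const, Finset.card_univ, nsmul_eq_mul, mul_zero, add_zero, ← hc, mul_one]
  rw [Real.exp_add]
  have := Real.add_one_le_exp (4 * t ^ 2)
  calc Real.exp (t * m) * (c + c * (4 * t ^ 2))
      = c * (Real.exp (t * m) * (4 * t ^ 2 + 1)) := by ring
    _ ≤ _ := by gcongr

lemma decomposeFin_symm_swap_mul {N : ℕ} (p : Fin (N + 1)) (a b : Fin N)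
    (e : Equiv.Perm (Fin N)) :
    ∃ a' b', Equiv.Perm.decomposeFin.symm (p, Equiv.swap a b * e) =
      Equiv.swap a' b' * Equiv.Perm.decomposeFin.symm (p, e) := by
  refine ⟨Equiv.swap 0 p a.succ, Equiv.swap 0 p b.succ, ?_⟩
  ext x
  refine Fin.cases ?_ (fun y => ?_) x
  · simp only [Equiv.Perm.decomposeFin_symm_apply_zero, Equiv.Perm.mul_apply]
    congr 1
    symm
    apply Equiv.swap_apply_of_ne_of_ne
    · intro h
      have : Equiv.swap 0 p 0 = Equiv.swap 0 p a.succ := by simpa using h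
      exact (Fin.succ_ne_zero a) ((Equiv.swap 0 p).injective this).symm
    · intro h
      have : Equiv.swap 0 p 0 = Equiv.swap 0 p b.succ := by simpa using h
      exact (Fin.succ_ne_zero b) ((Equiv.swap 0 p).injective this).symm
  · simp only [Equiv.Perm.decomposeFin_symm_apply_succ, Equiv.Perm.mul_apply]
    congr 1
    have h1 := (Fin.succ_injective N).swap_apply a b (e y)
    have h2 := (Equiv.swap 0 p).injective.swap_apply a.succ b.succ (e y).succ
    rw [h2, h1]

/-- Laplace transform bound for functions on the symmetric group which are `1`-Lipschitz with
respect to left multiplication by transpositions. -/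
theorem perm_fin_laplace (N : ℕ) : ∀ (f : Equiv.Perm (Fin N) → ℝ),
    (∀ a b σ, |f (Equiv.swap a b * σ) - f σ| ≤ 1) → ∀ t : ℝ, |t| ≤ 1 / 2 →
    ∑ σ, Real.exp (t * f σ) ≤
      N.factorial * Real.exp (t * ((∑ σ, f σ) / N.factorial) + 4 * N * t ^ 2) := by
  induction N with
  | zero => intro f hf t ht; simp
  | succ N ih =>
    intro f hf t ht
    set F : Fin (N + 1) → Equiv.Perm (Fin N) → ℝ :=
      fun p e => f (Equiv.Perm.decomposeFin.symm (p, e)) with hF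
    have hsum : ∀ g : ℝ → ℝ, ∑ σ, g (f σ) = ∑ p, ∑ e, g (F p e) := by
      intro g
      rw [← Equiv.Perm.decomposeFin.symm.sum_comp, Fintype.sum_prod_type]
    have hN : (0 : ℝ) < N.factorial := by exact_mod_cast N.factorial_pos
    set m : Fin (N + 1) → ℝ := fun p => (∑ e, F p e) / N.factorial with hm
    have hstep : ∀ p, ∑ e, Real.exp (t * F p e) ≤
        N.factorial * Real.exp (t * m p + 4 * N * t ^ 2) := by
      intro p
      refine ih (F p) (fun a b σ => ?_) t ht
      obtain ⟨a', b', h⟩ := decomposeFin_symm_swap_mul p a b σ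
      simp only [hF, h]
      exact hf _ _ _
    have hosc : ∀ p q, |m p - m q| ≤ 2 := by
      intro p q
      simp only [hm]
      rw [← sub_div, abs_div, abs_of_pos hN, div_le_iff₀ hN, ← Finset.sum_sub_distrib]
      refine (Finset.abs_sum_le_sum_abs _ _).trans ?_
      have hb : ∀ e ∈ (Finset.univ : Finset (Equiv.Perm (Fin N))),
          |F p e - F q e| ≤ 2 := by
        intro e _
        have h0 : ∀ p, |F p e - F 0 e| ≤ 1 := by
          intro p
          have : Equiv.Perm.decomposeFin.symm (p, e) =
              Equiv.swap 0 p * Equiv.Perm.decomposeFin.symm (0, e) := by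
            ext x
            refine Fin.cases ?_ (fun y => ?_) x <;> simp
          simp only [hF, this]
          exact hf _ _ _
        have h1 := abs_le.1 (h0 p)
        have h2 := abs_le.1 (h0 q)
        rw [abs_le]; constructor <;> linarith
      refine (Finset.sum_le_sum hb).trans ?_
      simp [Fintype.card_perm, mul_comm]
    rw [hsum (fun y => Real.exp (t * y)), hsum (fun y => y)]
    refine (Finset.sum_le_sum fun p _ => hstep p).trans ?_
    have h1 := sum_exp_le_of_oscillation m t ht hosc
    have h2 : (∑ p, m p) / ((N : ℝ) + 1) = (∑ p, ∑ e, F p e) / (N + 1).factorial := by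
      simp only [hm]
      rw [← Finset.sum_div, div_div, Nat.factorial_succ]
      push_cast
      rw [mul_comm]
    simp only [Fintype.card_fin] at h1
    push_cast at h1 ⊢
    rw [h2] at h1
    simp only [Real.exp_add]
    rw [← Finset.mul_sum, ← Finset.sum_mul]
    rw [Real.exp_add] at h1
    calc (N.factorial : ℝ) * ((∑ p, Real.exp (t * m p)) * Real.exp (4 * N * t ^ 2))
        ≤ N.factorial * ((((N : ℝ) + 1) * (Real.exp (t * ((∑ p, ∑ e, F p e) /
            (N + 1).factorial)) * Real.exp (4 * t ^ 2))) * Real.exp (4 * N * t ^ 2)) := by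
          gcongr
      _ = _ := by
          have : 4 * ((N : ℝ) + 1) * t ^ 2 = 4 * t ^ 2 + 4 * N * t ^ 2 := by ring
          rw [this, Real.exp_add, Nat.factorial_succ]
          push_cast
          ring

/-- Laplace transform bound on the symmetric group of an arbitrary finite set. -/
theorem perm_laplace {H : Type*} [Fintype H] (f : Equiv.Perm H → ℝ)
    (hf : ∀ a b σ, |f (Equiv.swap a b * σ) - f σ| ≤ 1) (t : ℝ) (ht : |t| ≤ 1 / 2) :
    ∑ σ, Real.exp (t * f σ) ≤ (Fintype.card H).factorial *
      Real.exp (t * ((∑ σ, f σ) / (Fintype.card H).factorial) +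
        4 * (Fintype.card H) * t ^ 2) := by
  set E := Fintype.equivFin H
  have h := perm_fin_laplace (Fintype.card H) (fun σ => f (E.symm.permCongr σ))
    (fun a b σ => ?_) t ht
  · rw [E.symm.permCongr.sum_comp (fun σ => Real.exp (t * f σ)),
      E.symm.permCongr.sum_comp (fun σ => f σ)] at h
    exact h
  · have : E.symm.permCongr (Equiv.swap a b * σ) =
        Equiv.swap (E.symm a) (E.symm b) * E.symm.permCongr σ := by
      ext x
      simp only [Equiv.permCongr_apply, Equiv.Perm.mul_apply, Equiv.symm_symm]
      exact (E.symm.injective.swap_apply a b _).symm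
    simp only [this]
    exact hf _ _ _

/-- The number of points where two permutations disagree. -/
def permDist {H : Type*} [Fintype H] (σ σ' : Equiv.Perm H) : ℕ :=
  (Finset.univ.filter fun x => σ x ≠ σ' x).card

lemma permDist_swap_mul_le {H : Type*} [Fintype H] (a b : H) (σ σ' : Equiv.Perm H) :
    permDist (Equiv.swap a b * σ) σ' ≤ permDist σ σ' + 2 := by
  have hsub : (Finset.univ.filter fun x => (Equiv.swap a b * σ) x ≠ σ' x) ⊆
      (Finset.univ.filter fun x => σ x ≠ σ' x) ∪ {σ.symm a, σ.symm b} := by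
    intro x hx
    have hx' : Equiv.swap a b (σ x) ≠ σ' x := (Finset.mem_filter.1 hx).2
    simp only [Finset.mem_filter, Finset.mem_univ, true_and,
      Finset.mem_union, Finset.mem_insert, Finset.mem_singleton, Equiv.eq_symm_apply]
    by_contra! hcon
    rw [Equiv.swap_apply_of_ne_of_ne hcon.2.1 hcon.2.2] at hx'
    exact hx' hcon.1
  refine (Finset.card_le_card hsub).trans ((Finset.card_union_le _ _).trans ?_)
  exact Nat.add_le_add_left Finset.card_le_two _

/-- Two sets of permutations at large distance cannot both be large. -/
theorem perm_card_mul_card_le {H : Type*} [Fintype H] (A B : Finset (Equiv.Perm H)) (s : ℝ)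
    (hs : 0 ≤ s) (hsN : s ≤ 16 * Fintype.card H) (hN : 0 < Fintype.card H)
    (hAB : ∀ σ ∈ A, ∀ σ' ∈ B, s ≤ permDist σ' σ) :
    (A.card : ℝ) * B.card ≤ ((Fintype.card H).factorial : ℝ) ^ 2 *
      Real.exp (-(s ^ 2 / (128 * Fintype.card H))) := by
  rcases A.eq_empty_or_nonempty with rfl | hA
  · simp; positivity
  set N : ℝ := ((Fintype.card H : ℕ) : ℝ) with hNdef
  have hN0 : 0 < N := by rw [hNdef]; exact_mod_cast hN
  set g : Equiv.Perm H → ℕ := fun σ => A.inf' hA (fun a => permDist σ a) with hg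
  have hgle : ∀ a b σ, g (Equiv.swap a b * σ) ≤ g σ + 2 := by
    intro a b σ
    obtain ⟨x, hx, hx'⟩ := A.exists_mem_eq_inf' hA (fun a => permDist σ a)
    have h1 : g σ = permDist σ x := hx'
    rw [h1]
    exact (Finset.inf'_le _ hx).trans (permDist_swap_mul_le a b σ x)
  set f : Equiv.Perm H → ℝ := fun σ => (g σ : ℝ) / 2 with hf
  have hlip : ∀ a b σ, |f (Equiv.swap a b * σ) - f σ| ≤ 1 := by
    intro a b σ
    have h1 : (g (Equiv.swap a b * σ) : ℝ) ≤ g σ + 2 := by exact_mod_cast hgle a b σ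
    have h2 : (g σ : ℝ) ≤ g (Equiv.swap a b * σ) + 2 := by
      have := hgle a b (Equiv.swap a b * σ)
      rw [← mul_assoc, Equiv.swap_mul_self, one_mul] at this
      exact_mod_cast this
    simp only [hf]
    rw [abs_le]; constructor <;> linarith
  have hfA : ∀ σ ∈ A, f σ = 0 := by
    intro σ hσ
    have : g σ ≤ permDist σ σ := Finset.inf'_le _ hσ
    have h0 : permDist σ σ = 0 := by simp [permDist]
    simp only [hf]
    rw [h0, Nat.le_zero] at this
    simp [this]
  have hfB : ∀ σ ∈ B, s / 2 ≤ f σ := by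
    intro σ hσ
    obtain ⟨x, hx, hx'⟩ := A.exists_mem_eq_inf' hA (fun a => permDist σ a)
    have h1 : g σ = permDist σ x := hx'
    have := hAB x hx σ hσ
    simp only [hf, h1]
    linarith
  set t : ℝ := s / (32 * N) with ht
  have ht0 : 0 ≤ t := by positivity
  have ht1 : |t| ≤ 1 / 2 := by
    rw [abs_of_nonneg ht0, ht, div_le_iff₀ (by positivity)]; linarith
  set P : ℝ := ((Fintype.card H).factorial : ℝ) with hP
  set m : ℝ := (∑ σ, f σ) / P with hm
  have hB := perm_laplace f hlip t ht1
  have hA' := perm_laplace f hlip (-t) (by rwa [abs_neg])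
  have e1 : (A.card : ℝ) ≤ ∑ σ, Real.exp (-t * f σ) := by
    calc (A.card : ℝ) = ∑ σ ∈ A, Real.exp (-t * f σ) := by
          rw [Finset.sum_congr rfl (fun σ hσ => by rw [hfA σ hσ, mul_zero, Real.exp_zero])]
          simp
      _ ≤ _ := Finset.sum_le_sum_of_subset_of_nonneg (Finset.subset_univ _)
          (fun _ _ _ => (Real.exp_pos _).le)
  have e2 : (B.card : ℝ) * Real.exp (t * (s / 2)) ≤ ∑ σ, Real.exp (t * f σ) := by
    calc (B.card : ℝ) * Real.exp (t * (s / 2)) = ∑ σ ∈ B, Real.exp (t * (s / 2)) := by simp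
      _ ≤ ∑ σ ∈ B, Real.exp (t * f σ) := by
          refine Finset.sum_le_sum fun σ hσ => Real.exp_le_exp.2 ?_
          exact mul_le_mul_of_nonneg_left (hfB σ hσ) ht0
      _ ≤ _ := Finset.sum_le_sum_of_subset_of_nonneg (Finset.subset_univ _)
          (fun _ _ _ => (Real.exp_pos _).le)
  have h1 := mul_le_mul (e1.trans hA') (e2.trans hB) (by positivity) (by positivity)
  have h2 : (P * Real.exp (-t * m + 4 * N * (-t) ^ 2)) * (P * Real.exp (t * m + 4 * N * t ^ 2))
      = P ^ 2 * Real.exp (8 * N * t ^ 2) := by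
    have : 8 * N * t ^ 2 = (-t * m + 4 * N * (-t) ^ 2) + (t * m + 4 * N * t ^ 2) := by ring
    rw [this, Real.exp_add (-t * m + 4 * N * (-t) ^ 2)]; ring
  rw [h2] at h1
  have h3 : -(s ^ 2 / (128 * N)) = 8 * N * t ^ 2 - t * (s / 2) := by
    rw [ht]; field_simp; ring
  rw [h3, Real.exp_sub, ← mul_div_assoc, le_div_iff₀ (Real.exp_pos _)]
  linarith

/-- The perfect matchings of the set of half-edges `Fin n × Fin d`, as fixed-point-free
involutions. -/
def matchings (n d : ℕ) : Finset (Equiv.Perm (Fin n × Fin d)) :=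
  Finset.univ.filter fun τ => ∀ h, τ h ≠ h ∧ τ (τ h) = h

lemma mem_matchings {n d : ℕ} {τ : Equiv.Perm (Fin n × Fin d)} :
    τ ∈ matchings n d ↔ ∀ h, τ h ≠ h ∧ τ (τ h) = h := by
  simp [matchings]

/-- The half-edges that belong to a loop or to a multiple edge of the multigraph given by a
perfect matching of the half-edges. -/
def defects {n d : ℕ} (τ : Equiv.Perm (Fin n × Fin d)) : Finset (Fin n × Fin d) :=
  Finset.univ.filter fun h =>
    (τ h).1 = h.1 ∨ ∃ h', h' ≠ h ∧ h'.1 = h.1 ∧ (τ h').1 = (τ h).1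

lemma mem_defects {n d : ℕ} {τ : Equiv.Perm (Fin n × Fin d)} {h : Fin n × Fin d} :
    h ∈ defects τ ↔ (τ h).1 = h.1 ∨ ∃ h', h' ≠ h ∧ h'.1 = h.1 ∧ (τ h').1 = (τ h).1 := by
  simp [defects]

/-- Conjugation of a permutation by a transposition: a switching of two edges. -/
def switchPerm {H : Type*} [DecidableEq H] (k g : H) (τ : Equiv.Perm H) : Equiv.Perm H :=
  Equiv.swap k g * τ * Equiv.swap k g

lemma switchPerm_apply {H : Type*} [DecidableEq H] (k g : H) (τ : Equiv.Perm H) (x : H) :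
    switchPerm k g τ x = Equiv.swap k g (τ (Equiv.swap k g x)) := rfl

lemma switchPerm_switchPerm {H : Type*} [DecidableEq H] (k g : H) (τ : Equiv.Perm H) :
    switchPerm k g (switchPerm k g τ) = τ := by
  ext x
  simp [switchPerm_apply]

lemma switchPerm_mem_matchings {n d : ℕ} {τ : Equiv.Perm (Fin n × Fin d)}
    (hτ : τ ∈ matchings n d) (k g : Fin n × Fin d) : switchPerm k g τ ∈ matchings n d := by
  rw [mem_matchings] at hτ ⊢
  intro h
  have h1 := hτ (Equiv.swap k g h)
  refine ⟨fun hc => h1.1 ?_, ?_⟩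
  · rw [switchPerm_apply] at hc
    rw [← Equiv.swap_apply_self k g (τ (Equiv.swap k g h)), hc]
  · simp [switchPerm_apply, h1.2]

lemma switchPerm_image_matchings_card {n d : ℕ} (h : Fin n × Fin d) :
    ((matchings n d).filter fun τ => h ∈ defects τ).card * (n * d - d) ≤
      (matchings n d).card * (d * (d + 1)) := by
  set Bad := (matchings n d).filter fun τ => h ∈ defects τ with hBad
  set Gs : Finset (Fin n × Fin d) := Finset.univ.filter fun g => g.1 ≠ h.1 with hGs
  set K : Equiv.Perm (Fin n × Fin d) → Finset (Fin n × Fin d) := fun τ =>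
    insert h.1 (Finset.univ.image fun i => (τ (h.1, i)).1) ×ˢ Finset.univ with hK
  have hGcard : Gs.card = n * d - d := by
    have : Gs = ({h.1}ᶜ : Finset (Fin n)) ×ˢ (Finset.univ : Finset (Fin d)) := by
      ext g; simp [hGs]
    rw [this, Finset.card_product, Finset.card_compl]
    simp [Nat.sub_mul]
  have hKcard : ∀ τ, (K τ).card ≤ d * (d + 1) := by
    intro τ
    simp only [hK, Finset.card_product, Finset.card_univ, Fintype.card_fin]
    rw [mul_comm]
    refine Nat.mul_le_mul_left _ ((Finset.card_insert_le _ _).trans ?_)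
    have := Finset.card_image_le (s := (Finset.univ : Finset (Fin d)))
      (f := fun i => (τ (h.1, i)).1)
    simp only [Finset.card_univ, Fintype.card_fin] at this
    omega
  have hinj : (Bad ×ˢ Gs).card ≤ ((matchings n d).sigma K).card := by
    refine Finset.card_le_card_of_injOn
      (fun p => ⟨switchPerm (p.1 h) p.2 p.1, p.1 h⟩) ?_ ?_
    · rintro ⟨τ, g⟩ hp
      obtain ⟨h1, h2⟩ := Finset.mem_product.1 (Finset.mem_coe.1 hp)
      obtain ⟨hτ', hdef'⟩ := Finset.mem_filter.1 h1
      have hτ : τ ∈ matchings n d := hτ'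
      have hdef : h ∈ defects τ := hdef'
      have hg : g.1 ≠ h.1 := (Finset.mem_filter.1 h2).2
      refine Finset.mem_coe.2 (Finset.mem_sigma.2 ⟨switchPerm_mem_matchings hτ _ _, ?_⟩)
      have hm : ∀ x, τ x ≠ x ∧ τ (τ x) = x := mem_matchings.1 hτ
      have hgh : g ≠ h := fun e => hg (by rw [e])
      have hτ'h : switchPerm (τ h) g τ h = g := by
        rw [switchPerm_apply, Equiv.swap_apply_of_ne_of_ne (hm h).1.symm hgh.symm,
          Equiv.swap_apply_left]
      simp only [hK, Finset.mem_product, Finset.mem_univ, and_true, Finset.mem_insert,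
        Finset.mem_image, true_and]
      rcases mem_defects.1 hdef with h3 | ⟨h', hne, hv, hv'⟩
      · exact Or.inl h3
      · by_cases hk : h' = τ h
        · left; rw [← hk, hv]
        right
        have hg' : h' ≠ g := fun e => hg (by rw [← e, hv])
        have e1 : switchPerm (τ h) g τ h' = Equiv.swap (τ h) g (τ h') := by
          rw [switchPerm_apply, Equiv.swap_apply_of_ne_of_ne hk hg']
        by_cases hc : τ h' = g
        · refine ⟨h.2, ?_⟩
          rw [Prod.mk.eta, hτ'h, ← hc, hv']
        · refine ⟨h'.2, ?_⟩
          rw [← hv, Prod.mk.eta, e1,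
            Equiv.swap_apply_of_ne_of_ne (fun e => hne (τ.injective e)) hc, hv']
    · rintro ⟨τ, g⟩ hp ⟨τ₂, g₂⟩ hp₂ heq
      have key : ∀ (τ : Equiv.Perm (Fin n × Fin d)) g, (τ, g) ∈ Bad ×ˢ Gs →
          switchPerm (τ h) g τ h = g := by
        intro τ g hp
        obtain ⟨h1, h2⟩ := Finset.mem_product.1 hp
        have hm : ∀ x, τ x ≠ x ∧ τ (τ x) = x := mem_matchings.1 (Finset.mem_filter.1 h1).1
        have hgh : g ≠ h := fun e => (Finset.mem_filter.1 h2).2 (by rw [e])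
        rw [switchPerm_apply, Equiv.swap_apply_of_ne_of_ne (hm h).1.symm hgh.symm,
          Equiv.swap_apply_left]
      simp only [Sigma.mk.injEq, heq_eq_eq] at heq
      have hg : g = g₂ := by
        rw [← key τ g hp, ← key τ₂ g₂ hp₂, heq.1]
      subst hg
      have : τ = τ₂ := by
        rw [← switchPerm_switchPerm (τ h) g τ, heq.1, heq.2, switchPerm_switchPerm]
      rw [this]
  rw [Finset.card_product, hGcard, Finset.card_sigma] at hinj
  refine hinj.trans ((Finset.sum_le_sum fun τ _ => hKcard τ).trans ?_)
  simp

/-- The mean number of defects of a uniform perfect matching is bounded. -/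
lemma sum_card_defects_le {n d : ℕ} (hn : 2 ≤ n) (hd : 1 ≤ d) :
    ∑ τ ∈ matchings n d, (defects τ).card ≤ 2 * (d * (d + 1)) * (matchings n d).card := by
  have h1 : ∑ τ ∈ matchings n d, (defects τ).card =
      ∑ h, ((matchings n d).filter fun τ => h ∈ defects τ).card := by
    have := Finset.sum_card_bipartiteAbove_eq_sum_card_bipartiteBelow
      (s := matchings n d) (t := Finset.univ) (fun τ h => h ∈ defects τ)
    simpa [Finset.bipartiteAbove, Finset.bipartiteBelow] using this
  have h2 : (∑ τ ∈ matchings n d, (defects τ).card) * (n * d - d) ≤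
      (n * d) * ((matchings n d).card * (d * (d + 1))) := by
    rw [h1, Finset.sum_mul]
    refine (Finset.sum_le_sum fun h _ => switchPerm_image_matchings_card h).trans ?_
    simp
  obtain ⟨m, rfl⟩ : ∃ m, n = m + 2 := ⟨n - 2, by omega⟩
  have h3 : (m + 2) * d - d = (m + 1) * d := by
    rw [← Nat.sub_one_mul]; rfl
  rw [h3] at h2
  have h4 : 0 < (m + 1) * d := by positivity
  refine Nat.le_of_mul_le_mul_right (h2.trans ?_) h4
  have h5 : (m + 2) ≤ 2 * (m + 1) := by omega
  calc (m + 2) * d * ((matchings (m + 2) d).card * (d * (d + 1)))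
      ≤ (2 * (m + 1)) * d * ((matchings (m + 2) d).card * (d * (d + 1))) := by gcongr
    _ = _ := by ring

lemma defects_switch_subset {n d : ℕ} {τ : Equiv.Perm (Fin n × Fin d)}
    (hτ : τ ∈ matchings n d) {h g : Fin n × Fin d}
    (hgd : g ∉ defects τ)
    (h1 : g.1 ≠ h.1) (h2 : g.1 ≠ (τ h).1) (h3 : (τ g).1 ≠ h.1) (h4 : (τ g).1 ≠ (τ h).1)
    (h5 : ∀ x, x.1 = h.1 → (τ x).1 ≠ g.1 ∧ (τ x).1 ≠ (τ g).1)
    (h6 : ∀ x, x.1 = (τ h).1 → (τ x).1 ≠ g.1 ∧ (τ x).1 ≠ (τ g).1)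
    {x : Fin n × Fin d} (hx : x ∈ defects (switchPerm (τ h) g τ)) :
    x ∈ defects τ ∧ x ≠ h := by
  have hm := mem_matchings.1 hτ
  set τ' := switchPerm (τ h) g τ with hτ'
  have hgl : (τ g).1 ≠ g.1 := fun e => hgd (mem_defects.2 (Or.inl e))
  have i1 : h ≠ g := fun e => h1 (by rw [e])
  have i2 : τ g ≠ τ h := fun e => h4 (by rw [e])
  have i3 : τ g ≠ g := (hm g).1
  have e1 : τ' h = g := by
    rw [hτ', switchPerm_apply, Equiv.swap_apply_of_ne_of_ne (hm h).1.symm i1,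
      Equiv.swap_apply_left]
  have e2 : τ' g = h := by
    rw [hτ', switchPerm_apply, Equiv.swap_apply_right, (hm h).2,
      Equiv.swap_apply_of_ne_of_ne (hm h).1.symm i1]
  have e3 : τ' (τ h) = τ g := by
    rw [hτ', switchPerm_apply, Equiv.swap_apply_left, Equiv.swap_apply_of_ne_of_ne i2 i3]
  have e4 : τ' (τ g) = τ h := by
    rw [hτ', switchPerm_apply, Equiv.swap_apply_of_ne_of_ne i2 i3, (hm g).2,
      Equiv.swap_apply_right]
  have e5 : ∀ y, y ≠ h → y ≠ g → y ≠ τ h → y ≠ τ g → τ' y = τ y := by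
    intro y y1 y2 y3 y4
    rw [hτ', switchPerm_apply, Equiv.swap_apply_of_ne_of_ne y3 y2,
      Equiv.swap_apply_of_ne_of_ne (fun e => y1 (τ.injective e))
        (fun e => y4 (by rw [← e, (hm y).2]))]
  have hh := hm h
  have hg := hm g
  have key : ∀ y y', y.1 = y'.1 → (τ' y).1 = (τ' y').1 →
      (y = h ∨ y = g ∨ y = τ h ∨ y = τ g) → y' = y := by
    intro y y' a b c
    have f1 := h5 y'
    have f2 := h6 y'
    have f3 := h5 (τ y')
    have f4 := h6 (τ y')
    have f5 := (hm y').2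
    by_cases c1 : y' = h
    · grind
    by_cases c2 : y' = g
    · grind
    by_cases c3 : y' = τ h
    · grind
    by_cases c4 : y' = τ g
    · grind
    have := e5 y' c1 c2 c3 c4
    rcases c with rfl | rfl | rfl | rfl <;> grind
  rw [mem_defects] at hx ⊢
  have hnew : ¬ (x = h ∨ x = g ∨ x = τ h ∨ x = τ g) := by
    intro c
    rcases hx with hx | ⟨x', n1, n2, n3⟩
    · grind
    · exact n1 (key x x' n2.symm n3.symm c)
  have hxo : τ' x = τ x := by
    apply e5 <;> grind
  refine ⟨?_, by grind⟩
  rcases hx with hx | ⟨x', n1, n2, n3⟩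
  · left; rw [← hxo]; exact hx
  · right
    refine ⟨x', n1, n2, ?_⟩
    by_cases c : x' = h ∨ x' = g ∨ x' = τ h ∨ x' = τ g
    · exact absurd (key x' x n2 n3 c) (fun e => n1 e.symm)
    · rw [← hxo, ← n3, e5 x'] <;> grind

/-- A perfect matching with few defects has a switching with fewer defects. -/
lemma exists_switch_defects_lt {n d K : ℕ} (hN : 2 * ((2 * d + 2) * d) + K < n * d)
    {τ : Equiv.Perm (Fin n × Fin d)} (hτ : τ ∈ matchings n d)
    (hK : (defects τ).card ≤ K) (hne : (defects τ).Nonempty) :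
    ∃ k g, (defects (switchPerm k g τ)).card < (defects τ).card := by
  obtain ⟨h, hh⟩ := hne
  have hm := mem_matchings.1 hτ
  set S : Finset (Fin n) := insert h.1 (insert (τ h).1
    ((Finset.univ.image fun i => (τ (h.1, i)).1) ∪
      (Finset.univ.image fun i => (τ ((τ h).1, i)).1))) with hS
  have hScard : S.card ≤ 2 * d + 2 := by
    have a1 := Finset.card_image_le (s := (Finset.univ : Finset (Fin d)))
      (f := fun i => (τ (h.1, i)).1)
    have a2 := Finset.card_image_le (s := (Finset.univ : Finset (Fin d)))
      (f := fun i => (τ ((τ h).1, i)).1)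
    simp only [Finset.card_univ, Fintype.card_fin] at a1 a2
    have a3 := Finset.card_union_le (Finset.univ.image fun i => (τ (h.1, i)).1)
      (Finset.univ.image fun i => (τ ((τ h).1, i)).1)
    refine (Finset.card_insert_le _ _).trans ?_
    have := Finset.card_insert_le (τ h).1 ((Finset.univ.image fun i => (τ (h.1, i)).1) ∪
      (Finset.univ.image fun i => (τ ((τ h).1, i)).1))
    omega
  set T : Finset (Fin n × Fin d) := S ×ˢ Finset.univ with hT
  have hTcard : T.card ≤ (2 * d + 2) * d := by
    rw [hT, Finset.card_product]
    simpa using Nat.mul_le_mul_right d hScard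
  have hex : ∃ g, g ∉ T ∪ T.image τ ∪ defects τ := by
    by_contra! hall
    have : (Finset.univ : Finset (Fin n × Fin d)).card ≤ (T ∪ T.image τ ∪ defects τ).card :=
      Finset.card_le_card fun g _ => hall g
    have b1 := Finset.card_union_le (T ∪ T.image τ) (defects τ)
    have b2 := Finset.card_union_le T (T.image τ)
    have b3 := Finset.card_image_le (s := T) (f := τ)
    simp only [Finset.card_univ, Fintype.card_prod, Fintype.card_fin] at this
    omega
  obtain ⟨g, hg⟩ := hex
  simp only [Finset.mem_union, not_or] at hg
  obtain ⟨⟨g1, g2⟩, g3⟩ := hg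
  have g1' : g.1 ∉ S := fun hc => g1 (by simp [hT, hc])
  have g2' : (τ g).1 ∉ S := fun hc =>
    g2 (Finset.mem_image.2 ⟨τ g, by simp [hT, hc], (hm g).2⟩)
  have hS1 : ∀ y ∉ S, y ≠ h.1 ∧ y ≠ (τ h).1 ∧ (∀ x : Fin n × Fin d, x.1 = h.1 → (τ x).1 ≠ y) ∧
      (∀ x : Fin n × Fin d, x.1 = (τ h).1 → (τ x).1 ≠ y) := by
    intro y hy
    simp only [hS, Finset.mem_insert, Finset.mem_union, Finset.mem_image, Finset.mem_univ,
      true_and, not_or, not_exists] at hy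
    refine ⟨hy.1, hy.2.1, fun x hx => ?_, fun x hx => ?_⟩
    · have := hy.2.2.1 x.2
      rwa [← hx] at this
    · have := hy.2.2.2 x.2
      rwa [← hx] at this
  obtain ⟨p1, p2, p3, p4⟩ := hS1 _ g1'
  obtain ⟨q1, q2, q3, q4⟩ := hS1 _ g2'
  have hsub := fun x hx => defects_switch_subset (x := x) hτ g3 p1 p2 q1 q2
    (fun x hx => ⟨p3 x hx, q3 x hx⟩) (fun x hx => ⟨p4 x hx, q4 x hx⟩) hx
  refine ⟨τ h, g, Finset.card_lt_card ?_⟩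
  rw [Finset.ssubset_iff_of_subset (fun x hx => (hsub x hx).1)]
  exact ⟨h, hh, fun hc => (hsub h hc).2 rfl⟩

/-- The matchings with at most `j` defects are at most polynomially more numerous than the
simple ones. -/
lemma card_defects_le_le {n d K : ℕ} (hN : 2 * ((2 * d + 2) * d) + K < n * d) (j : ℕ)
    (hj : j ≤ K) :
    ((matchings n d).filter fun τ => (defects τ).card ≤ j).card ≤
      (n * d) ^ (2 * j) * ((matchings n d).filter fun τ => (defects τ).card = 0).card := by
  induction j with
  | zero => simp
  | succ j ih =>
    have ih := ih (by omega)
    have hsub : ((matchings n d).filter fun τ => (defects τ).card ≤ j + 1) ⊆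
        (Finset.univ : Finset ((Fin n × Fin d) × (Fin n × Fin d))).biUnion fun p =>
          ((matchings n d).filter fun τ => (defects τ).card ≤ j).image
            (switchPerm p.1 p.2) := by
      intro τ hτ
      obtain ⟨h1, h2⟩ := Finset.mem_filter.1 hτ
      simp only [Finset.mem_biUnion, Finset.mem_univ, true_and, Finset.mem_image,
        Finset.mem_filter]
      by_cases hle : (defects τ).card ≤ j
      · have : 0 < n * d := by omega
        have hn : 0 < n := Nat.pos_of_mul_pos_right this
        have hd : 0 < d := Nat.pos_of_mul_pos_left this
        refine ⟨((⟨0, hn⟩, ⟨0, hd⟩), (⟨0, hn⟩, ⟨0, hd⟩)), τ, ⟨h1, hle⟩, ?_⟩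
        ext x <;> simp [switchPerm_apply]
      · obtain ⟨k, g, hlt⟩ := exists_switch_defects_lt hN h1 (by omega)
          (Finset.card_pos.1 (by omega))
        exact ⟨(k, g), switchPerm k g τ, ⟨switchPerm_mem_matchings h1 k g, by omega⟩,
          switchPerm_switchPerm _ _ _⟩
    refine (Finset.card_le_card hsub).trans (Finset.card_biUnion_le.trans ?_)
    refine (Finset.sum_le_sum fun p _ => Finset.card_image_le.trans ih).trans ?_
    simp only [Finset.sum_const, Finset.card_univ, Fintype.card_prod, Fintype.card_fin,
      smul_eq_mul]
    apply le_of_eq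
    ring

/-- A uniform perfect matching is simple with at least inverse polynomial probability. -/
theorem card_matchings_le {n d : ℕ} (hd : 1 ≤ d)
    (hN : 2 * ((2 * d + 2) * d) + 4 * (d * (d + 1)) < n * d) :
    (matchings n d).card ≤ 2 * ((n * d) ^ (2 * (4 * (d * (d + 1)))) *
      ((matchings n d).filter fun τ => (defects τ).card = 0).card) := by
  set K := 4 * (d * (d + 1)) with hK
  have hn : 2 ≤ n := by
    by_contra! hn
    have : n * d ≤ 1 * d := Nat.mul_le_mul_right _ (by omega)
    have : 1 * d ≤ d * (d + 1) := by nlinarith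
    omega
  have h1 := card_defects_le_le hN K le_rfl
  have h2 := sum_card_defects_le (n := n) hn hd
  have h3 := Finset.card_filter_add_card_filter_not (s := matchings n d)
    (fun τ => (defects τ).card ≤ K)
  have h4 : ((matchings n d).filter fun τ => ¬ (defects τ).card ≤ K).card * K ≤
      ∑ τ ∈ matchings n d, (defects τ).card := by
    rw [← smul_eq_mul]
    refine (Finset.card_nsmul_le_sum _ _ K fun τ hτ => ?_).trans
      (Finset.sum_le_sum_of_subset (Finset.filter_subset _ _))
    have := (Finset.mem_filter.1 hτ).2
    omega
  have hK0 : 0 < d * (d + 1) := by positivity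
  have h5 : 2 * ((matchings n d).filter fun τ => ¬ (defects τ).card ≤ K).card ≤
      (matchings n d).card := by
    have := h4.trans h2
    rw [hK] at this
    refine Nat.le_of_mul_le_mul_left ?_ (show 0 < 2 * (d * (d + 1)) by positivity)
    rw [← hK] at this
    calc _ = ((matchings n d).filter fun τ => ¬ (defects τ).card ≤ K).card * K := by
          rw [hK]; ring
      _ ≤ _ := this
  omega

/-- The simple graph underlying a perfect matching of the half-edges. -/
def matchGraph {n d : ℕ} (τ : Equiv.Perm (Fin n × Fin d)) : SimpleGraph (Fin n) :=
  SimpleGraph.fromRel fun v w => ∃ i, (τ (v, i)).1 = w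

/-- The perfect matchings whose multigraph is simple. -/
def simpleMatchings (n d : ℕ) : Finset (Equiv.Perm (Fin n × Fin d)) :=
  (matchings n d).filter fun τ => (defects τ).card = 0

lemma mem_simpleMatchings {n d : ℕ} {τ : Equiv.Perm (Fin n × Fin d)} :
    τ ∈ simpleMatchings n d ↔ τ ∈ matchings n d ∧ ∀ v i, (τ (v, i)).1 ≠ v ∧
      ∀ j, (τ (v, j)).1 = (τ (v, i)).1 → j = i := by
  rw [simpleMatchings, Finset.mem_filter, Finset.card_eq_zero,
    Finset.eq_empty_iff_forall_notMem]
  refine and_congr_right fun _ => ⟨fun h v i => ?_, fun h x hx => ?_⟩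
  · have := h (v, i)
    rw [mem_defects, not_or] at this
    refine ⟨this.1, fun j hj => ?_⟩
    by_contra hne
    exact this.2 ⟨(v, j), fun e => hne (congrArg Prod.snd e), rfl, hj⟩
  · rcases mem_defects.1 hx with h1 | ⟨y, h1, h2, h3⟩
    · exact (h x.1 x.2).1 h1
    · refine h1 (Prod.ext h2 ((h x.1 x.2).2 y.2 ?_))
      rw [← h2]
      rw [h3, h2]

lemma matchGraph_adj {n d : ℕ} {τ : Equiv.Perm (Fin n × Fin d)} (hτ : τ ∈ matchings n d)
    {v w : Fin n} : (matchGraph τ).Adj v w ↔ v ≠ w ∧ ∃ i, (τ (v, i)).1 = w := by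
  have hm := mem_matchings.1 hτ
  rw [matchGraph, SimpleGraph.fromRel_adj]
  refine and_congr_right fun _ => ⟨?_, Or.inl⟩
  rintro (h | ⟨i, hi⟩)
  · exact h
  · refine ⟨(τ (w, i)).2, ?_⟩
    rw [← hi, Prod.mk.eta, (hm _).2]

lemma matchGraph_adj_of_simple {n d : ℕ} {τ : Equiv.Perm (Fin n × Fin d)}
    (hτ : τ ∈ simpleMatchings n d) {v w : Fin n} :
    (matchGraph τ).Adj v w ↔ ∃ i, (τ (v, i)).1 = w := by
  obtain ⟨h1, h2⟩ := mem_simpleMatchings.1 hτ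
  rw [matchGraph_adj h1, and_iff_right_iff_imp]
  rintro ⟨i, hi⟩ rfl
  exact (h2 v i).1 hi

lemma matchGraph_mem_regularGraphs {n d : ℕ} {τ : Equiv.Perm (Fin n × Fin d)}
    (hτ : τ ∈ simpleMatchings n d) : matchGraph τ ∈ regularGraphs d n := by
  intro v
  have h : (matchGraph τ).neighborSet v = Set.range fun i => (τ (v, i)).1 := by
    ext w
    simp [SimpleGraph.mem_neighborSet, matchGraph_adj_of_simple hτ]
  rw [h, Set.ncard_eq_toFinset_card', Set.toFinset_range, Finset.card_image_of_injective]
  · simp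
  · intro j i hj
    exact ((mem_simpleMatchings.1 hτ).2 v i).2 j hj

/-- The matching of the half-edges obtained from labelings of the neighborhoods of a graph. -/
def labelMatching {n d : ℕ} {G : SimpleGraph (Fin n)} (b : ∀ v, Fin d ≃ G.neighborSet v) :
    Equiv.Perm (Fin n × Fin d) :=
  Function.Involutive.toPerm
    (fun h => ((b h.1 h.2 : Fin n), (b (b h.1 h.2)).symm ⟨h.1, G.adj_symm (b h.1 h.2).2⟩))
    (by
      rintro ⟨v, i⟩
      have key : ∀ v', v' = v → ((b v i : Fin n)) = b v' i := by
        rintro _ rfl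
        rfl
      refine Prod.ext (by simp) ?_
      dsimp only
      rw [Equiv.symm_apply_eq]
      exact Subtype.ext (key _ (by simp)))

lemma labelMatching_apply_fst {n d : ℕ} {G : SimpleGraph (Fin n)}
    (b : ∀ v, Fin d ≃ G.neighborSet v) (h : Fin n × Fin d) :
    (labelMatching b h).1 = b h.1 h.2 := rfl

lemma labelMatching_mem {n d : ℕ} {G : SimpleGraph (Fin n)}
    (b : ∀ v, Fin d ≃ G.neighborSet v) : labelMatching b ∈ simpleMatchings n d := by
  have hne : ∀ v i, (labelMatching b (v, i)).1 ≠ v := fun v i e =>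
    G.ne_of_adj (b v i).2 (by simpa [labelMatching_apply_fst] using e.symm)
  refine mem_simpleMatchings.2 ⟨mem_matchings.2 fun h => ⟨fun e => ?_, ?_⟩, fun v i =>
    ⟨hne v i, fun j hj => ?_⟩⟩
  · exact hne h.1 h.2 (congrArg Prod.fst e)
  · exact Function.Involutive.toPerm_involutive _ h
  · exact (b v).injective (Subtype.ext hj)

lemma matchGraph_labelMatching {n d : ℕ} {G : SimpleGraph (Fin n)}
    (b : ∀ v, Fin d ≃ G.neighborSet v) : matchGraph (labelMatching b) = G := by
  ext v w
  rw [matchGraph_adj_of_simple (labelMatching_mem b)]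
  constructor
  · rintro ⟨i, rfl⟩
    exact (b v i).2
  · intro h
    exact ⟨(b v).symm ⟨w, h⟩, by simp [labelMatching_apply_fst]⟩

lemma labelMatching_injective {n d : ℕ} {G : SimpleGraph (Fin n)} :
    Function.Injective (labelMatching (d := d) (G := G)) := by
  intro b b' h
  funext v
  ext i
  have := congrArg (fun τ : Equiv.Perm (Fin n × Fin d) => (τ (v, i)).1) h
  simpa [labelMatching_apply_fst] using congrArg Fin.val this

lemma exists_labelMatching_eq {n d : ℕ} {τ : Equiv.Perm (Fin n × Fin d)}
    (hτ : τ ∈ simpleMatchings n d) :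
    ∃ b : ∀ v, Fin d ≃ (matchGraph τ).neighborSet v, labelMatching b = τ := by
  obtain ⟨h1, h2⟩ := mem_simpleMatchings.1 hτ
  have hbij : ∀ v, Function.Bijective (fun i : Fin d =>
      (⟨(τ (v, i)).1, (matchGraph_adj_of_simple hτ).2 ⟨i, rfl⟩⟩ :
        (matchGraph τ).neighborSet v)) := by
    intro v
    refine ⟨fun j i hj => (h2 v i).2 j (congrArg Subtype.val hj), fun w => ?_⟩
    obtain ⟨i, hi⟩ := (matchGraph_adj_of_simple hτ).1 w.2
    exact ⟨i, Subtype.ext hi⟩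
  refine ⟨fun v => Equiv.ofBijective _ (hbij v), ?_⟩
  ext1 ⟨v, i⟩
  refine Prod.ext rfl ?_
  set b : ∀ v, Fin d ≃ (matchGraph τ).neighborSet v := fun v => Equiv.ofBijective _ (hbij v)
  change (b _).symm _ = _
  rw [Equiv.symm_apply_eq]
  apply Subtype.ext
  change v = (τ ((τ (v, i)).1, (τ (v, i)).2)).1
  rw [Prod.mk.eta, (mem_matchings.1 h1 _).2]

/-- Each regular graph comes from the same number of simple matchings. -/
lemma card_filter_matchGraph_eq {n d : ℕ} {G : SimpleGraph (Fin n)}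
    (hG : G ∈ regularGraphs d n) :
    ((simpleMatchings n d).filter fun τ => matchGraph τ = G).card = d.factorial ^ n := by
  have h1 : ((simpleMatchings n d).filter fun τ => matchGraph τ = G) =
      Finset.univ.image (labelMatching (d := d) (G := G)) := by
    ext τ
    simp only [Finset.mem_filter, Finset.mem_image, Finset.mem_univ, true_and]
    constructor
    · rintro ⟨h, rfl⟩
      exact exists_labelMatching_eq h
    · rintro ⟨b, rfl⟩
      exact ⟨labelMatching_mem b, matchGraph_labelMatching b⟩
  rw [h1, Finset.card_image_of_injective _ labelMatching_injective, Finset.card_univ,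
    Fintype.card_pi]
  have h2 : ∀ v, Fintype.card (Fin d ≃ G.neighborSet v) = d.factorial := by
    intro v
    have hc : Fintype.card (G.neighborSet v) = d := by
      rw [← Nat.card_eq_fintype_card, Nat.card_coe_set_eq]
      exact hG v
    have e : Fin d ≃ G.neighborSet v := Fintype.equivOfCardEq (by simp [hc])
    rw [Fintype.card_equiv e, Fintype.card_fin]
  simp [h2]

lemma card_filter_matchGraph_mem {n d : ℕ} (A : Finset (SimpleGraph (Fin n)))
    (hA : ∀ G ∈ A, G ∈ regularGraphs d n) :
    ((simpleMatchings n d).filter fun τ => matchGraph τ ∈ A).card =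
      A.card * d.factorial ^ n := by
  refine (Finset.card_eq_sum_card_fiberwise (f := matchGraph) (t := A)
    (fun τ hτ => (Finset.mem_filter.1 hτ).2)).trans ?_
  rw [← smul_eq_mul, ← Finset.sum_const]
  refine Finset.sum_congr rfl fun G hG => ?_
  rw [← card_filter_matchGraph_eq (hA G hG), Finset.filter_filter]
  congr 1
  refine Finset.filter_congr fun τ _ => ?_
  constructor
  · exact fun h => h.2
  · rintro rfl
    exact ⟨hG, rfl⟩

lemma card_simpleMatchings {n d : ℕ} (R : Finset (SimpleGraph (Fin n)))
    (hR : ∀ G, G ∈ R ↔ G ∈ regularGraphs d n) :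
    (simpleMatchings n d).card = R.card * d.factorial ^ n := by
  rw [← card_filter_matchGraph_mem R fun G hG => (hR G).1 hG, Finset.filter_true_of_mem]
  exact fun τ hτ => (hR _).2 (matchGraph_mem_regularGraphs hτ)

lemma isConj_of_mem_matchings {n d : ℕ} {τ τ' : Equiv.Perm (Fin n × Fin d)}
    (hτ : τ ∈ matchings n d) (hτ' : τ' ∈ matchings n d) : IsConj τ τ' := by
  rcases isEmpty_or_nonempty (Fin n × Fin d) with hE | ⟨⟨x⟩⟩
  · rw [Subsingleton.elim τ τ']
  have key : ∀ ρ ∈ matchings n d, ρ.cycleType = Multiset.replicate (n * d / 2) 2 := by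
    intro ρ hρ
    have hm := mem_matchings.1 hρ
    have ho : orderOf ρ = 2 := by
      refine orderOf_eq_prime ?_ fun e => (hm x).1 (by rw [e]; rfl)
      ext1 y
      rw [pow_two, Equiv.Perm.mul_apply, (hm y).2, Equiv.Perm.one_apply]
    obtain ⟨m, hm'⟩ := Equiv.Perm.cycleType_prime_order (σ := ρ) (by rw [ho]; exact Nat.prime_two)
    rw [ho] at hm'
    have hs : ρ.support = Finset.univ := by
      ext y
      simp [(hm y).1]
    have h2 := ρ.sum_cycleType
    rw [hm', hs, Multiset.sum_replicate, Finset.card_univ] at h2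
    simp only [smul_eq_mul, Fintype.card_prod, Fintype.card_fin] at h2
    rw [hm']
    congr 1
    omega
  rw [Equiv.Perm.isConj_iff_cycleType_eq, key τ hτ, key τ' hτ']

lemma conj_mem_matchings {n d : ℕ} {τ : Equiv.Perm (Fin n × Fin d)}
    (hτ : τ ∈ matchings n d) (σ : Equiv.Perm (Fin n × Fin d)) :
    σ * τ * σ⁻¹ ∈ matchings n d := by
  have hm := mem_matchings.1 hτ
  refine mem_matchings.2 fun h => ⟨fun e => (hm (σ⁻¹ h)).1 ?_, ?_⟩
  · exact σ.injective (by simpa using e)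
  · simp [(hm _).2]

/-- Conjugating a fixed perfect matching by a uniform permutation yields a uniform perfect
matching. -/
lemma card_filter_conj_mem {n d : ℕ} {τ₀ : Equiv.Perm (Fin n × Fin d)}
    (hτ₀ : τ₀ ∈ matchings n d) (T : Finset (Equiv.Perm (Fin n × Fin d)))
    (hT : T ⊆ matchings n d) :
    ((Finset.univ : Finset (Equiv.Perm (Fin n × Fin d))).filter
      fun σ => σ * τ₀ * σ⁻¹ ∈ T).card = T.card *
      ((Finset.univ : Finset (Equiv.Perm (Fin n × Fin d))).filter
        fun σ => σ * τ₀ * σ⁻¹ = τ₀).card := by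
  refine (Finset.card_eq_sum_card_fiberwise (f := fun σ => σ * τ₀ * σ⁻¹) (t := T)
    (fun τ hτ => (Finset.mem_filter.1 hτ).2)).trans ?_
  rw [← smul_eq_mul, ← Finset.sum_const]
  refine Finset.sum_congr rfl fun τ hτ => ?_
  obtain ⟨c, hc⟩ := isConj_iff.1 (isConj_of_mem_matchings hτ₀ (hT hτ))
  refine Finset.card_bij' (fun σ _ => c⁻¹ * σ) (fun σ _ => c * σ) ?_ ?_ ?_ ?_
  · intro σ hσ
    have h := (Finset.mem_filter.1 hσ).2
    refine Finset.mem_filter.2 ⟨Finset.mem_univ _, ?_⟩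
    have : c⁻¹ * σ * τ₀ * (c⁻¹ * σ)⁻¹ = c⁻¹ * (σ * τ₀ * σ⁻¹) * c := by group
    rw [this, h, ← hc]
    group
  · intro σ hσ
    have h := (Finset.mem_filter.1 hσ).2
    have : c * σ * τ₀ * (c * σ)⁻¹ = τ := by
      rw [← hc]
      conv_rhs => rw [← h]
      group
    refine Finset.mem_filter.2 ⟨Finset.mem_filter.2 ⟨Finset.mem_univ _, ?_⟩, this⟩
    change c * σ * τ₀ * (c * σ)⁻¹ ∈ T
    rwa [this]
  · intro σ _
    simp
  · intro σ _
    simp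

/-- The vertices having different neighborhoods in two graphs. -/
def diffSet {n : ℕ} (G G' : SimpleGraph (Fin n)) : Finset (Fin n) :=
  Finset.univ.filter fun v => G.neighborSet v ≠ G'.neighborSet v

lemma card_diffSet_le {n d : ℕ} {τ₀ : Equiv.Perm (Fin n × Fin d)} (hτ₀ : τ₀ ∈ matchings n d)
    (σ σ' : Equiv.Perm (Fin n × Fin d)) :
    (diffSet (matchGraph (σ * τ₀ * σ⁻¹)) (matchGraph (σ' * τ₀ * σ'⁻¹))).card ≤
      2 * permDist σ σ' := by
  set D : Finset (Fin n × Fin d) := Finset.univ.filter fun x => σ x ≠ σ' x with hD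
  have hsub : diffSet (matchGraph (σ * τ₀ * σ⁻¹)) (matchGraph (σ' * τ₀ * σ'⁻¹)) ⊆
      (D.image fun x => (σ x).1) ∪ D.image fun x => (σ (τ₀ x)).1 := by
    intro v hv
    by_contra hn
    refine (Finset.mem_filter.1 hv).2 ?_
    have heq : ∀ i, (σ * τ₀ * σ⁻¹) (v, i) = (σ' * τ₀ * σ'⁻¹) (v, i) := by
      intro i
      have h1 : σ (σ⁻¹ (v, i)) = σ' (σ⁻¹ (v, i)) := by
        by_contra hc
        exact hn (Finset.mem_union_left _ (Finset.mem_image.2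
          ⟨σ⁻¹ (v, i), Finset.mem_filter.2 ⟨Finset.mem_univ _, hc⟩, by simp⟩))
      have h2 : σ (τ₀ (σ⁻¹ (v, i))) = σ' (τ₀ (σ⁻¹ (v, i))) := by
        by_contra hc
        exact hn (Finset.mem_union_right _ (Finset.mem_image.2
          ⟨τ₀ (σ⁻¹ (v, i)), Finset.mem_filter.2 ⟨Finset.mem_univ _, hc⟩,
            by simp [(mem_matchings.1 hτ₀ _).2]⟩))
      have h3 : σ'⁻¹ (v, i) = σ⁻¹ (v, i) := by
        rw [Equiv.Perm.inv_eq_iff_eq, ← h1]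
        simp
      simp only [Equiv.Perm.mul_apply]
      rw [h3, h2]
    ext w
    rw [SimpleGraph.mem_neighborSet, SimpleGraph.mem_neighborSet,
      matchGraph_adj (conj_mem_matchings hτ₀ σ), matchGraph_adj (conj_mem_matchings hτ₀ σ')]
    simp only [heq]
  have h1 : (D.image fun x => (σ x).1).card ≤ D.card := Finset.card_image_le
  have h2 : (D.image fun x => (σ (τ₀ x)).1).card ≤ D.card := Finset.card_image_le
  have h3 := (Finset.card_le_card hsub).trans (Finset.card_union_le _ _)
  have h4 : D.card = permDist σ σ' := by
    rw [hD, permDist]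
    congr
  omega

/-- Isoperimetry for uniform random regular graphs: two sets of regular graphs that are far
apart cannot both be large. -/
theorem regular_card_mul_card_le {n d : ℕ} (hd : 1 ≤ d)
    (hN : 2 * ((2 * d + 2) * d) + 4 * (d * (d + 1)) < n * d)
    (R A B : Finset (SimpleGraph (Fin n))) (hR : ∀ G, G ∈ R ↔ G ∈ regularGraphs d n)
    (hA : A ⊆ R) (hB : B ⊆ R) (s : ℝ) (hs0 : 0 ≤ s) (hs : s ≤ n)
    (hAB : ∀ G ∈ A, ∀ G' ∈ B, s ≤ (diffSet G G').card) :
    (A.card : ℝ) * B.card ≤ (R.card : ℝ) ^ 2 *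
      (4 * ((n * d : ℕ) : ℝ) ^ (4 * (4 * (d * (d + 1)))) *
        Real.exp (-(s ^ 2 / (512 * (n * d : ℕ))))) := by
  rcases R.eq_empty_or_nonempty with rfl | hRne
  · rw [Finset.subset_empty.1 hA]
    simp
  have hRc := card_simpleMatchings R hR
  have hfact : 0 < d.factorial ^ n := pow_pos d.factorial_pos n
  have hsimple : (simpleMatchings n d).Nonempty := by
    rw [← Finset.card_pos, hRc]
    exact Nat.mul_pos hRne.card_pos hfact
  obtain ⟨τ₀, hτ₀'⟩ := hsimple
  have hτ₀ : τ₀ ∈ matchings n d := (mem_simpleMatchings.1 hτ₀').1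
  set S := ((Finset.univ : Finset (Equiv.Perm (Fin n × Fin d))).filter
        fun σ => σ * τ₀ * σ⁻¹ = τ₀).card with hS
  have hSpos : 0 < S := Finset.card_pos.2 ⟨1, by simp⟩
  have lift : ∀ A : Finset (SimpleGraph (Fin n)), A ⊆ R →
      ((Finset.univ : Finset (Equiv.Perm (Fin n × Fin d))).filter fun σ => σ * τ₀ * σ⁻¹ ∈
        (simpleMatchings n d).filter fun τ => matchGraph τ ∈ A).card =
        A.card * d.factorial ^ n * S := by
    intro A hA
    rw [card_filter_conj_mem hτ₀, card_filter_matchGraph_mem A fun G hG => (hR G).1 (hA hG)]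
    exact fun τ hτ => (mem_simpleMatchings.1 (Finset.mem_filter.1 hτ).1).1
  have htot : (n * d).factorial = (matchings n d).card * S := by
    rw [hS, ← card_filter_conj_mem hτ₀ _ subset_rfl, Finset.filter_true_of_mem
      fun σ _ => conj_mem_matchings hτ₀ σ, Finset.card_univ, Fintype.card_perm]
    simp
  have hmain := perm_card_mul_card_le
    ((Finset.univ : Finset (Equiv.Perm (Fin n × Fin d))).filter fun σ => σ * τ₀ * σ⁻¹ ∈
        (simpleMatchings n d).filter fun τ => matchGraph τ ∈ A)
    ((Finset.univ : Finset (Equiv.Perm (Fin n × Fin d))).filter fun σ => σ * τ₀ * σ⁻¹ ∈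
        (simpleMatchings n d).filter fun τ => matchGraph τ ∈ B) (s / 2) (by positivity)
    (by
      have h1 : (n : ℝ) ≤ (n * d : ℕ) := by exact_mod_cast Nat.le_mul_of_pos_right n hd
      simp only [Fintype.card_prod, Fintype.card_fin]
      linarith)
    (by simp only [Fintype.card_prod, Fintype.card_fin]; omega)
    (by
      intro σ hσ σ' hσ'
      have h1 := (Finset.mem_filter.1 (Finset.mem_filter.1 hσ).2).2
      have h2 := (Finset.mem_filter.1 (Finset.mem_filter.1 hσ').2).2
      have h3 := hAB _ h1 _ h2
      have h4 := card_diffSet_le hτ₀ σ σ'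
      have h5 : permDist σ' σ = permDist σ σ' := by
        rw [permDist, permDist]
        congr 1
        ext x
        simp [eq_comm]
      have h6 : ((diffSet (matchGraph (σ * τ₀ * σ⁻¹)) (matchGraph (σ' * τ₀ * σ'⁻¹))).card : ℝ) ≤
        2 * permDist σ σ' := by exact_mod_cast h4
      rw [h5]
      linarith)
  rw [lift A hA, lift B hB] at hmain
  simp only [Fintype.card_prod, Fintype.card_fin] at hmain
  rw [htot] at hmain
  have hmatch : (matchings n d).card ≤ 2 * ((n * d) ^ (2 * (4 * (d * (d + 1)))) *
      (R.card * d.factorial ^ n)) := by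
    rw [← hRc]
    exact card_matchings_le hd hN
  set P : ℝ := ((d.factorial ^ n * S : ℕ) : ℝ) with hP
  have hPpos : 0 < P := by rw [hP]; exact_mod_cast Nat.mul_pos hfact hSpos
  have hexp : (s / 2) ^ 2 / (128 * ((n * d : ℕ) : ℝ)) = s ^ 2 / (512 * ((n * d : ℕ) : ℝ)) := by
    rw [div_pow, div_div]
    congr 1
    ring
  rw [hexp] at hmain
  set E := Real.exp (-(s ^ 2 / (512 * ((n * d : ℕ) : ℝ)))) with hE
  have hM : (((matchings n d).card * S : ℕ) : ℝ) ≤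
      2 * ((n * d : ℕ) : ℝ) ^ (2 * (4 * (d * (d + 1)))) * R.card * P := by
    have : (matchings n d).card * S ≤ 2 * ((n * d) ^ (2 * (4 * (d * (d + 1)))) *
      (R.card * d.factorial ^ n)) * S := Nat.mul_le_mul_right _ hmatch
    calc (((matchings n d).card * S : ℕ) : ℝ) ≤ ((2 * ((n * d) ^ (2 * (4 * (d * (d + 1)))) *
      (R.card * d.factorial ^ n)) * S : ℕ) : ℝ) := by exact_mod_cast this
      _ = _ := by rw [hP]; push_cast; ring
  have hfin : (A.card : ℝ) * B.card * P ^ 2 ≤ ((R.card : ℝ) ^ 2 *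
      (4 * ((n * d : ℕ) : ℝ) ^ (4 * (4 * (d * (d + 1)))) * E)) * P ^ 2 := by
    calc (A.card : ℝ) * B.card * P ^ 2
        = ((A.card * d.factorial ^ n * S : ℕ) : ℝ) * ((B.card * d.factorial ^ n * S : ℕ) : ℝ) := by
          rw [hP]; push_cast; ring
      _ ≤ _ := hmain
      _ ≤ (2 * ((n * d : ℕ) : ℝ) ^ (2 * (4 * (d * (d + 1)))) * R.card * P) ^ 2 * E := by
          gcongr
      _ = _ := by ring
  exact le_of_mul_le_mul_right hfin (by positivity)

lemma reachable_and_dist_eq_iff {n : ℕ} (G : SimpleGraph (Fin n)) (v w : Fin n) (k : ℕ) :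
    (G.Reachable v w ∧ G.dist v w = k) ↔
      (∃ p : G.Walk v w, p.length = k) ∧ ∀ j < k, ¬ ∃ p : G.Walk v w, p.length = j := by
  constructor
  · rintro ⟨h, rfl⟩
    refine ⟨h.exists_walk_length_eq_dist, ?_⟩
    rintro j hj ⟨p, rfl⟩
    exact absurd (G.dist_le p) (by omega)
  · rintro ⟨⟨p, rfl⟩, h⟩
    refine ⟨⟨p⟩, le_antisymm (G.dist_le p) ?_⟩
    by_contra! hlt
    exact h _ hlt (SimpleGraph.Reachable.exists_walk_length_eq_dist ⟨p⟩)

lemma exists_walk_succ_iff {n : ℕ} (G : SimpleGraph (Fin n)) (v w : Fin n) (k : ℕ) :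
    (∃ p : G.Walk v w, p.length = k + 1) ↔
      ∃ u, (∃ p : G.Walk v u, p.length = k) ∧ G.Adj u w := by
  constructor
  · rintro ⟨p, hp⟩
    obtain ⟨u, h, q, hq⟩ : ∃ u, ∃ h : G.Adj w u, ∃ q : G.Walk u v, q.length = k := by
      have hr : p.reverse.length = k + 1 := by simpa using hp
      cases hpr : p.reverse with
      | nil => rw [hpr] at hr; simp at hr
      | cons h q => rw [hpr] at hr; exact ⟨_, h, q, by simpa using hr⟩
    exact ⟨u, ⟨q.reverse, by simpa using hq⟩, h.symm⟩
  · rintro ⟨u, ⟨p, hp⟩, h⟩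
    exact ⟨p.concat h, by simp [hp]⟩

/-- The ball of radius `r` around `v` in `G` avoids all vertices at which `G` and `G'` differ. -/
def AgreeNear {n : ℕ} (G G' : SimpleGraph (Fin n)) (r : ℕ) (v : Fin n) : Prop :=
  ∀ u, ∀ p : G.Walk v u, p.length ≤ r → G.neighborSet u = G'.neighborSet u

section Agree

variable {n : ℕ} {G G' : SimpleGraph (Fin n)} {r : ℕ} {v : Fin n}

lemma AgreeNear.walk_iff (h : AgreeNear G G' r v) {k : ℕ} (hk : k ≤ r) (w : Fin n) :
    (∃ p : G.Walk v w, p.length = k) ↔ ∃ p : G'.Walk v w, p.length = k := by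
  induction k generalizing w with
  | zero =>
    constructor <;>
    · rintro ⟨p, hp⟩
      obtain rfl := p.eq_of_length_eq_zero hp
      exact ⟨SimpleGraph.Walk.nil, rfl⟩
  | succ k ih =>
    rw [exists_walk_succ_iff, exists_walk_succ_iff]
    refine exists_congr fun u => ?_
    rw [← ih (by omega) u]
    refine and_congr_right fun ⟨p, hp⟩ => ?_
    have := h u p (by omega)
    exact Set.ext_iff.1 this w

lemma AgreeNear.dist_iff (h : AgreeNear G G' r v) {k : ℕ} (hk : k ≤ r) (w : Fin n) :
    (G.Reachable v w ∧ G.dist v w = k) ↔ G'.Reachable v w ∧ G'.dist v w = k := by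
  rw [reachable_and_dist_eq_iff, reachable_and_dist_eq_iff, h.walk_iff hk]
  refine and_congr_right fun _ => forall₂_congr fun j hj => ?_
  rw [h.walk_iff (by omega)]

lemma AgreeNear.adj_iff (h : AgreeNear G G' r v) {u : Fin n} (hu : G.Reachable v u)
    (hk : G.dist v u ≤ r) (w : Fin n) : G.Adj u w ↔ G'.Adj u w := by
  obtain ⟨p, hp⟩ := hu.exists_walk_length_eq_dist
  exact Set.ext_iff.1 (h u p (by omega)) w

lemma mem_bfsLayer {σ : Equiv.Perm (Fin n)} {k : ℕ} {u : Fin n} (hu : u ∈ bfsLayer G v σ k) :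
    G.Reachable v u ∧ G.dist v u = k := by
  cases k with
  | zero =>
    obtain rfl : u = v := by simpa [bfsLayer] using hu
    exact ⟨SimpleGraph.Reachable.refl _, SimpleGraph.dist_self⟩
  | succ k =>
    rw [bfsLayer, List.mem_mergeSort, List.mem_filter] at hu
    exact of_decide_eq_true hu.2

lemma AgreeNear.find?_eq (h : AgreeNear G G' r v) {σ : Equiv.Perm (Fin n)} {k : ℕ} (hk : k ≤ r)
    (w : Fin n) : (bfsLayer G v σ k).find? (fun u => decide (G.Adj u w)) =
      (bfsLayer G v σ k).find? (fun u => decide (G'.Adj u w)) := by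
  refine List.find?_congr fun u hu => ?_
  obtain ⟨h1, h2⟩ := mem_bfsLayer hu
  exact decide_eq_decide.2 (h.adj_iff h1 (by omega) w)

lemma AgreeNear.bfsLayer_eq (h : AgreeNear G G' r v) (σ : Equiv.Perm (Fin n)) {k : ℕ}
    (hk : k ≤ r) : bfsLayer G v σ k = bfsLayer G' v σ k := by
  induction k with
  | zero => rfl
  | succ k ih =>
    have ih := ih (by omega)
    have hf := fun w => h.find?_eq (σ := σ) (k := k) (by omega) w
    rw [ih] at hf
    rw [bfsLayer, bfsLayer, ih]
    simp only [hf, h.dist_iff hk]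

lemma AgreeNear.bfsPathAux_eq (h : AgreeNear G G' r v) (σ : Equiv.Perm (Fin n)) {k : ℕ}
    (hk : k ≤ r) (w : Fin n) : bfsPathAux G v σ k w = bfsPathAux G' v σ k w := by
  induction k generalizing w with
  | zero => rfl
  | succ k ih =>
    have hf := fun w => h.find?_eq (σ := σ) (k := k) (by omega) w
    rw [h.bfsLayer_eq σ (by omega)] at hf
    simp only [bfsPathAux, h.bfsLayer_eq σ hk, h.bfsLayer_eq σ (show k ≤ r by omega), hf,
      ih (show k ≤ r by omega)]

lemma length_of_bfsPathAux {σ : Equiv.Perm (Fin n)} {k : ℕ} {w : Fin n} {l : List ℕ}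
    (h : bfsPathAux G v σ k w = some l) : l.length = k := by
  induction k generalizing w l with
  | zero =>
    rw [bfsPathAux] at h
    split_ifs at h
    obtain rfl : [] = l := by simpa using h
    rfl
  | succ k ih =>
    rw [bfsPathAux] at h
    split at h
    · simp at h
    · obtain ⟨pl, h1, h2⟩ := Option.map_eq_some_iff.1 h
      rw [← h2, List.length_cons, ih h1]

lemma bfsPath_eq_some_iff {σ : Equiv.Perm (Fin n)} {w : Fin n} {l : List ℕ} :
    bfsPath G v σ w = some l ↔
      (G.Reachable v w ∧ G.dist v w = l.length) ∧ bfsPathAux G v σ l.length w = some l := by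
  rw [bfsPath]
  split_ifs with hr
  · constructor
    · intro h
      have := length_of_bfsPathAux h
      exact ⟨⟨hr, this.symm⟩, by rwa [this]⟩
    · rintro ⟨⟨-, h1⟩, h2⟩
      rwa [h1]
  · simp [hr]

lemma AgreeNear.bfsPath_iff (h : AgreeNear G G' r v) (σ : Equiv.Perm (Fin n)) {l : List ℕ}
    (hl : l.length ≤ r) (w : Fin n) :
    bfsPath G v σ w = some l ↔ bfsPath G' v σ w = some l := by
  rw [bfsPath_eq_some_iff, bfsPath_eq_some_iff, h.dist_iff hl, h.bfsPathAux_eq σ hl]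

/-- The restriction to the `r`-ball of the exploration from `v` only depends on the graph near
`v`. -/
lemma AgreeNear.resS_bfsRCG_eq {M : Type*} (h : AgreeNear G G' r v) (f : Fin n → M)
    (σ : Equiv.Perm (Fin n)) : resS r (bfsRCG G f v σ) = resS r (bfsRCG G' f v σ) := by
  apply RCG.ext
  · funext l
    simp only [resS]
    split_ifs with hl
    · have hp : (fun w => bfsPath G v σ w = some l) = fun w => bfsPath G' v σ w = some l :=
        funext fun w => propext (h.bfsPath_iff σ hl w)
      simp only [bfsRCG, hp]
    · rfl
  · funext p
    simp only [resS]
    split_ifs with hl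
    · simp only [bfsRCG]
      refine if_congr (exists_congr fun w₁ => exists_congr fun w₂ => ?_) rfl rfl
      rw [← h.bfsPath_iff σ hl.1, ← h.bfsPath_iff σ hl.2]
      refine and_congr_right fun h1 => and_congr_right fun _ => ?_
      obtain ⟨⟨h2, h3⟩, -⟩ := bfsPath_eq_some_iff.1 h1
      exact h.adj_iff h2 (by omega) w₂
    · rfl

end Agree

/-- The vertices joined to `u` by a walk of length `k`. -/
def walkSphere {n : ℕ} (G : SimpleGraph (Fin n)) (u : Fin n) (k : ℕ) : Finset (Fin n) :=
  Finset.univ.filter fun v => ∃ p : G.Walk u v, p.length = k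

lemma card_walkSphere_le {n d : ℕ} {G : SimpleGraph (Fin n)} (hG : G ∈ regularGraphs d n)
    (u : Fin n) (k : ℕ) : (walkSphere G u k).card ≤ d ^ k := by
  induction k with
  | zero =>
    rw [pow_zero, Finset.card_le_one]
    intro a ha b hb
    obtain ⟨p, hp⟩ := (Finset.mem_filter.1 ha).2
    obtain ⟨q, hq⟩ := (Finset.mem_filter.1 hb).2
    rw [← p.eq_of_length_eq_zero hp, q.eq_of_length_eq_zero hq]
  | succ k ih =>
    have hsub : walkSphere G u (k + 1) ⊆
        (walkSphere G u k).biUnion fun w => (G.neighborSet w).toFinset := by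
      intro w hw
      obtain ⟨x, hx, hadj⟩ := (exists_walk_succ_iff G u w k).1 (Finset.mem_filter.1 hw).2
      exact Finset.mem_biUnion.2 ⟨x, Finset.mem_filter.2 ⟨Finset.mem_univ _, hx⟩,
        by simpa using hadj⟩
    refine (Finset.card_le_card hsub).trans
      ((Finset.card_biUnion_le_card_mul _ _ d fun w _ => ?_).trans ?_)
    · rw [← Set.ncard_eq_toFinset_card', hG w]
    · rw [pow_succ]
      exact Nat.mul_le_mul_right _ ih

/-- A change of the graph affects the `r`-balls of few vertices. -/
lemma card_not_agreeNear_le {n d : ℕ} {G : SimpleGraph (Fin n)} (hG : G ∈ regularGraphs d n)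
    (G' : SimpleGraph (Fin n)) (r : ℕ) :
    ((Finset.univ : Finset (Fin n)).filter fun v => ¬ AgreeNear G G' r v).card ≤
      (diffSet G G').card * ∑ k ∈ Finset.range (r + 1), d ^ k := by
  have hsub : ((Finset.univ : Finset (Fin n)).filter fun v => ¬ AgreeNear G G' r v) ⊆
      (diffSet G G').biUnion fun u =>
        (Finset.range (r + 1)).biUnion fun k => walkSphere G u k := by
    intro v hv
    have h := (Finset.mem_filter.1 hv).2
    simp only [AgreeNear, not_forall] at h
    obtain ⟨u, p, hp, hne⟩ := h
    refine Finset.mem_biUnion.2 ⟨u, Finset.mem_filter.2 ⟨Finset.mem_univ _, hne⟩,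
      Finset.mem_biUnion.2 ⟨p.length, Finset.mem_range.2 (by omega),
        Finset.mem_filter.2 ⟨Finset.mem_univ _, p.reverse, by simp⟩⟩⟩
  refine (Finset.card_le_card hsub).trans (Finset.card_biUnion_le_card_mul _ _ _ fun u _ => ?_)
  exact Finset.card_biUnion_le.trans (Finset.sum_le_sum fun k _ => card_walkSphere_le hG u k)

lemma continuous_resS {M : Type*} (r : ℕ) : Continuous (resS r : RCG M → RCG M) := by
  have hcomm : ∀ (k : ℕ) (g : RCG M), resS k (resS r g) = resS r (resS k g) := by
    intro k g
    apply RCG.ext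
    · funext l
      simp only [resS]
      split_ifs <;> rfl
    · funext p
      simp only [resS]
      split_ifs <;> rfl
  refine (LipschitzWith.mk_one fun g g' => ?_).continuous
  refine Summable.tsum_le_tsum (fun k => ?_) (rcg_summable _ _) (rcg_summable _ _)
  by_cases h : resS k g = resS k g'
  · rw [if_pos h, if_pos (by rw [hcomm, hcomm, h])]
  · rw [if_neg h]
    split_ifs
    · positivity
    · exact le_rfl

lemma measurable_resS {M : Type*} (r : ℕ) : Measurable (resS r : RCG M → RCG M) :=
  (continuous_resS r).measurable

lemma distrAt_apply_le_one {M : Type*} {n : ℕ} (G : SimpleGraph (Fin n)) (f : Fin n → M)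
    (v : Fin n) (E : Set (RCG M)) : distrAt G f v E ≤ 1 := by
  rw [distrAt, Measure.smul_apply, Measure.finsetSum_apply, smul_eq_mul]
  calc ((n.factorial : ℝ≥0∞))⁻¹ * ∑ σ : Equiv.Perm (Fin n), Measure.dirac (bfsRCG G f v σ) E
      ≤ ((n.factorial : ℝ≥0∞))⁻¹ * ∑ σ : Equiv.Perm (Fin n), 1 := by
        gcongr
        exact prob_le_one
    _ = ((n.factorial : ℝ≥0∞))⁻¹ * n.factorial := by
        simp [Fintype.card_perm]
    _ ≤ 1 := ENNReal.inv_mul_le_one _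

lemma distrG_apply {M : Type*} {n : ℕ} (G : SimpleGraph (Fin n)) (f : Fin n → M)
    (E : Set (RCG M)) : distrG G f E = (n : ℝ≥0∞)⁻¹ * ∑ v, distrAt G f v E := by
  rw [distrG, Measure.smul_apply, Measure.finsetSum_apply, smul_eq_mul]

instance isFiniteMeasure_distrG {M : Type*} {n : ℕ} (G : SimpleGraph (Fin n)) (f : Fin n → M) :
    IsFiniteMeasure (distrG G f) := by
  refine ⟨lt_of_le_of_lt ?_ ENNReal.one_lt_top⟩
  rw [distrG_apply]
  calc (n : ℝ≥0∞)⁻¹ * ∑ v, distrAt G f v Set.univ ≤ (n : ℝ≥0∞)⁻¹ * ∑ v : Fin n, 1 := by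
        gcongr
        exact distrAt_apply_le_one _ _ _ _
    _ = (n : ℝ≥0∞)⁻¹ * n := by simp
    _ ≤ 1 := ENNReal.inv_mul_le_one _

lemma AgreeNear.distrAt_eq {M : Type*} {n r : ℕ} {G G' : SimpleGraph (Fin n)} {v : Fin n}
    (h : AgreeNear G G' r v) (f : Fin n → M) {E : Set (RCG M)} (hE : MeasurableSet E) :
    distrAt G f v (resS r ⁻¹' E) = distrAt G' f v (resS r ⁻¹' E) := by
  have hm : MeasurableSet (resS r ⁻¹' E : Set (RCG M)) := measurable_resS r hE
  rw [distrAt, distrAt, Measure.smul_apply, Measure.smul_apply, Measure.finsetSum_apply,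
    Measure.finsetSum_apply]
  congr 1
  refine Finset.sum_congr rfl fun σ _ => ?_
  rw [Measure.dirac_apply' _ hm, Measure.dirac_apply' _ hm]
  simp only [Set.indicator, Set.mem_preimage, h.resS_bfsRCG_eq f σ, Pi.one_apply]

lemma map_distrG_apply_le {M : Type*} {n r : ℕ} {G G' H H' : SimpleGraph (Fin n)} {K : ℕ}
    (hbad : ((Finset.univ : Finset (Fin n)).filter fun v => ¬ AgreeNear G G' r v).card ≤ K)
    (hH : H = G ∧ H' = G' ∨ H = G' ∧ H' = G)
    (f : Fin n → M) {E : Set (RCG M)} (hE : MeasurableSet E) :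
    (distrG H f).map (resS r) E ≤ (distrG H' f).map (resS r) E + (n : ℝ≥0∞)⁻¹ * K := by
  rw [Measure.map_apply (measurable_resS r) hE, Measure.map_apply (measurable_resS r) hE,
    distrG_apply, distrG_apply, ← mul_add]
  gcongr
  have hpt : ∀ v, distrAt H f v (resS r ⁻¹' E) ≤ distrAt H' f v (resS r ⁻¹' E) +
      if ¬ AgreeNear G G' r v then 1 else 0 := by
    intro v
    split_ifs with h
    · rw [add_zero]
      rcases hH with ⟨rfl, rfl⟩ | ⟨rfl, rfl⟩
      · exact (h.distrAt_eq f hE).le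
      · exact (h.distrAt_eq f hE).ge
    · exact (distrAt_apply_le_one _ _ _ _).trans le_add_self
  refine (Finset.sum_le_sum fun v _ => hpt v).trans ?_
  rw [Finset.sum_add_distrib]
  gcongr
  rw [Finset.sum_boole]
  exact_mod_cast hbad

/-- The empirical distribution of a coloring is a Lipschitz function of the graph. -/
lemma levyProkhorovDist_distrG_le {M : Type*} {n d r : ℕ} (hn : 0 < n)
    {G G' : SimpleGraph (Fin n)} (hG : G ∈ regularGraphs d n) (f : Fin n → M) :
    levyProkhorovDist ((distrG G f).map (resS r)) ((distrG G' f).map (resS r)) ≤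
      ((diffSet G G').card * ∑ k ∈ Finset.range (r + 1), d ^ k : ℕ) / (n : ℝ) := by
  set K := (diffSet G G').card * ∑ k ∈ Finset.range (r + 1), d ^ k with hK
  have hbad := card_not_agreeNear_le hG G' r
  have hle : levyProkhorovEDist ((distrG G f).map (resS r)) ((distrG G' f).map (resS r)) ≤
      (n : ℝ≥0∞)⁻¹ * K := by
    refine levyProkhorovEDist_le_of_forall _ _ _ fun ε E hε hε' hE => ?_
    have hsub : E ⊆ Metric.thickening ε.toReal E :=
      Metric.self_subset_thickening (ENNReal.toReal_pos (pos_of_gt hε).ne' hε'.ne) _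
    constructor
    · refine (map_distrG_apply_le hbad (Or.inl ⟨rfl, rfl⟩) f hE).trans ?_
      gcongr
    · refine (map_distrG_apply_le hbad (Or.inr ⟨rfl, rfl⟩) f hE).trans ?_
      gcongr
  have hn' : (n : ℝ≥0∞) ≠ 0 := by exact_mod_cast hn.ne'
  refine (ENNReal.toReal_mono ?_ hle).trans_eq ?_
  · exact ENNReal.mul_ne_top (ENNReal.inv_ne_top.2 hn') (ENNReal.natCast_ne_top _)
  · rw [ENNReal.toReal_mul, ENNReal.toReal_inv, ENNReal.toReal_natCast, ENNReal.toReal_natCast,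
      div_eq_inv_mul]

lemma FSet_subset {M : Type*} [MeasurableSpace M] {n d r : ℕ} (hn : 0 < n)
    (μ : Measure (TdVertex d → M)) [IsFiniteMeasure μ] {ε ε' : ℝ}
    {G G' : SimpleGraph (Fin n)} (hG' : G' ∈ regularGraphs d n)
    (h : ((diffSet G' G).card * ∑ k ∈ Finset.range (r + 1), d ^ k : ℕ) / (n : ℝ) ≤ ε' - ε) :
    FSet d μ r ε G ⊆ FSet d μ r ε' G' := by
  intro f hf
  have hf' : levyProkhorovDist ((distrG G f).map (resS r)) ((lawTd d μ).map (resS r)) ≤ ε := hf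
  have : IsFiniteMeasure (lawTd d μ) := by unfold lawTd; infer_instance
  have h1 := levyProkhorovDist_distrG_le (r := r) (G' := G) hn hG' f
  have h2 := levyProkhorovDist_triangle ((distrG G' f).map (resS r))
    ((distrG G f).map (resS r)) ((lawTd d μ).map (resS r))
  change levyProkhorovDist ((distrG G' f).map (resS r)) ((lawTd d μ).map (resS r)) ≤ ε'
  linarith

lemma HG_mono {M : Type*} [Finite M] [MeasurableSpace M] {n d r : ℕ}
    (μ : Measure (TdVertex d → M)) {ε ε' : ℝ} {G G' : SimpleGraph (Fin n)}
    (h : FSet d μ r ε G ⊆ FSet d μ r ε' G') : HG d μ r ε G ≤ HG d μ r ε' G' := by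
  rw [HG]
  split_ifs with h1
  · exact bot_le
  · have hne := Set.nonempty_iff_ne_empty.2 h1
    rw [HG, if_neg (hne.mono h).ne_empty, EReal.coe_le_coe_iff]
    gcongr
    · exact_mod_cast (Set.ncard_pos (Set.toFinite _)).2 hne
    · exact Set.toFinite _

lemma diffSet_comm {n : ℕ} (G G' : SimpleGraph (Fin n)) : diffSet G G' = diffSet G' G := by
  ext v
  simp [diffSet, eq_comm]

lemma eventually_isoperimetric_bound_lt {d : ℕ} (hd : 1 ≤ d) (k : ℕ) {c δ : ℝ} (hc : 0 < c)
    (hδ : 0 < δ) : ∀ᶠ n : ℕ in atTop, 4 * ((n * d : ℕ) : ℝ) ^ k *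
      Real.exp (-((c * n) ^ 2 / (512 * (n * d : ℕ)))) < δ := by
  have hd' : (0 : ℝ) < d := by exact_mod_cast hd
  have hb : 0 < c ^ 2 / (512 * d) := by positivity
  have h1 := ((tendsto_rpow_mul_exp_neg_mul_atTop_nhds_zero k _ hb).comp
    tendsto_natCast_atTop_atTop (α := ℕ)).const_mul (4 * (d : ℝ) ^ k)
  rw [mul_zero] at h1
  filter_upwards [h1.eventually_lt_const hδ, eventually_gt_atTop 0] with n h2 hn
  refine lt_of_eq_of_lt ?_ h2
  have hn' : (0 : ℝ) < n := by exact_mod_cast hn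
  have h3 : -((c * n) ^ 2 / (512 * ((n * d : ℕ) : ℝ))) = -(c ^ 2 / (512 * d)) * n := by
    push_cast
    field_simp
  rw [h3]
  simp only [Function.comp_apply, Real.rpow_natCast]
  push_cast
  ring

lemma hquant_le_hquant {M : Type*} [Finite M] [MeasurableSpace M] {d : ℕ} (hd : 1 ≤ d)
    (μ : Measure (TdVertex d → M)) [IsFiniteMeasure μ] (r : ℕ) {ε α α' : ℝ} (hε : 0 < ε)
    (hα : 0 < α) (hα' : α' < 1) :
    ∀ᶠ n in atTop, hquant d μ r (ε / 2) α n ≤ hquant d μ r ε α' n := by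
  set L : ℝ := ((∑ k ∈ Finset.range (r + 1), d ^ k : ℕ) : ℝ) with hL
  have hLpos : 0 < L := by
    rw [hL]
    exact_mod_cast Finset.sum_pos (fun k _ => pow_pos hd k) ⟨0, by simp⟩
  set c : ℝ := min 1 (ε / (2 * L)) with hc
  have hc0 : 0 < c := by positivity
  have hcL : c * L ≤ ε / 2 := by
    calc c * L ≤ ε / (2 * L) * L := by
          gcongr
          exact min_le_right _ _
      _ = ε / 2 := by field_simp
  filter_upwards [eventually_isoperimetric_bound_lt hd (4 * (4 * (d * (d + 1)))) hc0
    (mul_pos hα (sub_pos.2 hα')),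
    eventually_gt_atTop (2 * ((2 * d + 2) * d) + 4 * (d * (d + 1)))] with n hsmall hn
  refine sSup_le fun h hh => le_sSup ⟨hh.1, ?_⟩
  by_contra! hlt
  have hn0 : 0 < n := by omega
  have hn0' : (0 : ℝ) < n := by exact_mod_cast hn0
  set R : Finset (SimpleGraph (Fin n)) := (regularGraphs d n).toFinset with hR
  have hmemR : ∀ G, G ∈ R ↔ G ∈ regularGraphs d n := fun G => by simp [hR]
  have hPr : ∀ ε', PrG d n {G : SimpleGraph (Fin n) | h ≤ HG d μ r ε' G} =
      ((R.filter fun G => h ≤ HG d μ r ε' G).card : ℝ) / R.card := by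
    intro ε'
    rw [PrG, Set.ncard_eq_toFinset_card', Set.ncard_eq_toFinset_card']
    congr 3
    ext G
    simp [hR]
  have hA := hh.2
  rw [hPr] at hA hlt
  have hRpos : (0 : ℝ) < R.card := by
    rcases Nat.eq_zero_or_pos R.card with h0 | h0
    · rw [h0, Nat.cast_zero, div_zero] at hA
      exact absurd hA (not_le.2 hα)
    · exact_mod_cast h0
  rw [le_div_iff₀ hRpos] at hA
  rw [div_lt_iff₀ hRpos] at hlt
  have hsplit : ((R.filter fun G => h ≤ HG d μ r ε G).card : ℝ) +
      (R.filter fun G => ¬ h ≤ HG d μ r ε G).card = R.card := by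
    exact_mod_cast Finset.card_filter_add_card_filter_not _
  have hB : (1 - α') * R.card ≤ (R.filter fun G => ¬ h ≤ HG d μ r ε G).card := by linarith
  have hiso := regular_card_mul_card_le hd (hn.trans_le (Nat.le_mul_of_pos_right n hd)) R
    (R.filter fun G => h ≤ HG d μ r (ε / 2) G) (R.filter fun G => ¬ h ≤ HG d μ r ε G) hmemR
    (Finset.filter_subset _ _) (Finset.filter_subset _ _) (c * n) (by positivity)
    (by
      have : c ≤ 1 := min_le_left _ _
      nlinarith)
    (by
      intro G hG G' hG'
      obtain ⟨hG1, hG2⟩ := Finset.mem_filter.1 hG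
      obtain ⟨hG1', hG2'⟩ := Finset.mem_filter.1 hG'
      by_contra! hclose
      refine hG2' (hG2.trans (HG_mono μ (FSet_subset hn0 μ ((hmemR _).1 hG1') ?_)))
      rw [diffSet_comm, div_le_iff₀ hn0', Nat.cast_mul, ← hL]
      calc ((diffSet G G').card : ℝ) * L ≤ c * n * L := by gcongr
        _ = c * L * n := by ring
        _ ≤ (ε - ε / 2) * n := by
          gcongr
          linarith)
  have hprod : α * R.card * ((1 - α') * R.card) ≤
      ((R.filter fun G => h ≤ HG d μ r (ε / 2) G).card : ℝ) *
        (R.filter fun G => ¬ h ≤ HG d μ r ε G).card := by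
    have : 0 ≤ 1 - α' := by linarith
    gcongr
  have hfin := mul_lt_mul_of_pos_left hsmall (pow_pos hRpos 2)
  refine absurd (hprod.trans hiso) (not_le.2 (hfin.trans_eq ?_))
  ring

lemma iInf_le_iInf_of_half {F F' : {e : ℝ // 0 < e} → EReal}
    (h : ∀ e : {e : ℝ // 0 < e}, F ⟨e.1 / 2, half_pos e.2⟩ ≤ F' e) :
    ⨅ e, F e ≤ ⨅ e, F' e :=
  le_iInf fun e => (iInf_le _ _).trans (h e)

lemma hbarA_le {M : Type*} [Finite M] [MeasurableSpace M] {d : ℕ} (hd : 1 ≤ d)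
    (μ : Measure (TdVertex d → M)) [IsFiniteMeasure μ] (r : ℕ) {α α' : ℝ}
    (hα : 0 < α) (hα' : α' < 1) : hbarA d μ r α ≤ hbarA d μ r α' :=
  iInf_le_iInf_of_half fun e =>
    limsup_le_limsup ((hquant_le_hquant hd μ r e.2 hα hα').filter_mono inf_le_left)

lemma hlowA_le {M : Type*} [Finite M] [MeasurableSpace M] {d : ℕ} (hd : 1 ≤ d)
    (μ : Measure (TdVertex d → M)) [IsFiniteMeasure μ] (r : ℕ) {α α' : ℝ}
    (hα : 0 < α) (hα' : α' < 1) : hlowA d μ r α ≤ hlowA d μ r α' :=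
  iInf_le_iInf_of_half fun e =>
    liminf_le_liminf ((hquant_le_hquant hd μ r e.2 hα hα').filter_mono inf_le_left)

/-- For `d ≥ 3`, a finite color set `M`, an invariant probability measure
`μ ∈ I_d(M)` and `r ≥ 0`, the upper and lower entropies `h̄(μ,r,α)` and `h̲(μ,r,α)` do not
depend on the choice of `α ∈ (0,1)`. -/
theorem entropies_independent_of_alpha
    (d : ℕ) (hd : 3 ≤ d) (M : Type) [Fintype M] [MeasurableSpace M]
    [DiscreteMeasurableSpace M]
    (μ : Measure (TdVertex d → M)) (hμ : μ ∈ InvMeas d M) (r : ℕ)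
    (α α' : ℝ) (hα : α ∈ Set.Ioo (0:ℝ) 1) (hα' : α' ∈ Set.Ioo (0:ℝ) 1) :
    hbarA d μ r α = hbarA d μ r α' ∧ hlowA d μ r α = hlowA d μ r α' := by
  have : IsProbabilityMeasure μ := hμ.1
  have hd1 : 1 ≤ d := by omega
  exact ⟨le_antisymm (hbarA_le hd1 μ r hα.1 hα'.2) (hbarA_le hd1 μ r hα'.1 hα.2),
    le_antisymm (hlowA_le hd1 μ r hα.1 hα'.2) (hlowA_le hd1 μ r hα'.1 hα.2)⟩

end TreeEntropy
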